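/- Let g be a Riemannian metric on {x ∈ ℝ³ : |x| > 1} of the form g_{ij}(x) = δ_{ij} + h¹_{ij}(x/|x|)/|x| + Q_{ij}(x), where h¹ is a C⁵ symmetric-matrix-valued function on the unit sphere S² and Q satisfies |∂^α Q(x)| ≤ C |x|^{-2-|α|} for all multi-indices |α| ≤ 5, and where g(x) is positive definite for all |x| > 1. Then there exist R ≥ 1, a constant vector c ∈ ℝ³, a C² map G : S² → ℝ³, and C' > 0 such that the map y(x) = x + c log|x| + G(x/|x|) satisfies |Δ_g y^k(x)| ≤ C' |x|^{-3} for all |x| ≥ R and k = 1,2,3, and its Jacobian satisfies ∂y^k/∂x^i = δ_{ki} + O(|x|^{-1}); in particular y defines asymptotically harmonic coordinates near infinity. -/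

import Mathlib

open Real MeasureTheory

/-- Partial derivative `∂_i f` on Euclidean `ℝ³`. -/
noncomputable def pd3 (i : Fin 3) (f : EuclideanSpace ℝ (Fin 3) → ℝ)
    (x : EuclideanSpace ℝ (Fin 3)) : ℝ :=
  fderiv ℝ f x (EuclideanSpace.single i 1)

/-- The Laplace–Beltrami operator of a metric `g` (given as a matrix-valued function) in
coordinates: `Δ_g f = (det g)^{-1/2} ∂_i((det g)^{1/2} g^{ij} ∂_j f)`. -/
noncomputable def lapBel (g : EuclideanSpace ℝ (Fin 3) → Matrix (Fin 3) (Fin 3) ℝ)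
    (f : EuclideanSpace ℝ (Fin 3) → ℝ) (x : EuclideanSpace ℝ (Fin 3)) : ℝ :=
  (Real.sqrt (g x).det)⁻¹ *
    ∑ i, pd3 i (fun z => Real.sqrt (g z).det * ∑ j, ((g z)⁻¹ i j) * pd3 j f z) x

local notation "E3" => EuclideanSpace ℝ (Fin 3)

theorem pd3_eq_of_hasFDerivAt {f : E3 → ℝ} {f' : E3 →L[ℝ] ℝ} {x : E3} (h : HasFDerivAt f f' x)
    (i : Fin 3) : pd3 i f x = f' (EuclideanSpace.single i 1) := by
  rw [pd3, h.fderiv]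

theorem contDiff_pd3 {f : E3 → ℝ} {n : WithTop ℕ∞} (hf : ContDiff ℝ (n + 1) f) (i : Fin 3) :
    ContDiff ℝ n (pd3 i f) :=
  (hf.fderiv_right le_rfl).clm_apply contDiff_const

theorem hasCompactSupport_pd3 {f : E3 → ℝ} (hf : HasCompactSupport f) (i : Fin 3) :
    HasCompactSupport (pd3 i f) :=
  hf.fderiv_apply ℝ _

/-! ### The regularised Newton kernel -/

theorem contDiff_norm_sq_add_rpow {ε : ℝ} (hε : 0 < ε) (s : ℝ) {n : WithTop ℕ∞} :
    ContDiff ℝ n (fun z : E3 => (‖z‖ ^ 2 + ε ^ 2) ^ s) :=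
  ((contDiff_norm_sq ℝ).add contDiff_const).rpow_const_of_ne fun z => by positivity

theorem hasFDerivAt_norm_sq_add_rpow {ε : ℝ} (hε : 0 < ε) (s : ℝ) (z : E3) :
    HasFDerivAt (fun z : E3 => (‖z‖ ^ 2 + ε ^ 2) ^ s)
      ((s * (‖z‖ ^ 2 + ε ^ 2) ^ (s - 1)) • (2 • (innerSL ℝ) z)) z :=
  ((hasStrictFDerivAt_norm_sq z).hasFDerivAt.add_const (ε ^ 2)).rpow_const
    (Or.inl (by positivity))

theorem pd3_norm_sq_add_rpow {ε : ℝ} (hε : 0 < ε) (s : ℝ) (z : E3) (i : Fin 3) :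
    pd3 i (fun z : E3 => (‖z‖ ^ 2 + ε ^ 2) ^ s) z
      = z i * (2 * s * (‖z‖ ^ 2 + ε ^ 2) ^ (s - 1)) := by
  rw [pd3_eq_of_hasFDerivAt (hasFDerivAt_norm_sq_add_rpow hε s z)]
  simp [EuclideanSpace.inner_single_right]
  ring

theorem pd3_pd3_norm_sq_add_rpow {ε : ℝ} (hε : 0 < ε) (s : ℝ) (z : E3) (i : Fin 3) :
    pd3 i (pd3 i (fun z : E3 => (‖z‖ ^ 2 + ε ^ 2) ^ s)) z
      = 2 * s * (‖z‖ ^ 2 + ε ^ 2) ^ (s - 1)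
        + 4 * s * (s - 1) * z i ^ 2 * (‖z‖ ^ 2 + ε ^ 2) ^ (s - 2) := by
  have h1 : pd3 i (fun z : E3 => (‖z‖ ^ 2 + ε ^ 2) ^ s)
      = fun z => z i * (2 * s * (‖z‖ ^ 2 + ε ^ 2) ^ (s - 1)) := by
    funext z
    exact pd3_norm_sq_add_rpow hε s z i
  have h2 : HasFDerivAt (fun z : E3 => z i) (EuclideanSpace.proj i : E3 →L[ℝ] ℝ) z :=
    (EuclideanSpace.proj i : E3 →L[ℝ] ℝ).hasFDerivAt
  rw [h1, pd3_eq_of_hasFDerivAt (HasFDerivAt.fun_mul h2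
    ((hasFDerivAt_norm_sq_add_rpow hε (s - 1) z).const_mul _))]
  have : s - 1 - 1 = s - 2 := by ring
  simp [EuclideanSpace.inner_single_right, this]
  ring

theorem sum_pd3_pd3_newton_regularised {ε : ℝ} (hε : 0 < ε) (z : E3) :
    ∑ i, pd3 i (pd3 i (fun z : E3 => (‖z‖ ^ 2 + ε ^ 2) ^ (-(1 / 2) : ℝ))) z
      = -(3 * ε ^ 2 * (‖z‖ ^ 2 + ε ^ 2) ^ (-(5 / 2) : ℝ)) := by
  have hp : 0 < ‖z‖ ^ 2 + ε ^ 2 := by positivity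
  have hn : ‖z‖ ^ 2 = z 0 ^ 2 + z 1 ^ 2 + z 2 ^ 2 := by
    rw [EuclideanSpace.norm_sq_eq, Fin.sum_univ_three]; simp
  have e1 : (‖z‖ ^ 2 + ε ^ 2) ^ (-(1 / 2) - 1 : ℝ)
      = (‖z‖ ^ 2 + ε ^ 2) * (‖z‖ ^ 2 + ε ^ 2) ^ (-(5 / 2) : ℝ) := by
    rw [← Real.rpow_one_add' hp.le (by norm_num)]; norm_num
  have e2 : (-(1 / 2) - 2 : ℝ) = -(5 / 2) := by norm_num
  simp only [pd3_pd3_norm_sq_add_rpow hε, Fin.sum_univ_three, e1, e2]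
  generalize (‖z‖ ^ 2 + ε ^ 2) ^ (-(5 / 2) : ℝ) = P
  rw [hn]
  ring

theorem integral_mul_pd3 {f g : E3 → ℝ} (hf : ContDiff ℝ 1 f) (hg : ContDiff ℝ 1 g)
    (hgc : HasCompactSupport g) (i : Fin 3) :
    ∫ x, f x * pd3 i g x = -∫ x, pd3 i f x * g x := by
  have hf0 := hf.continuous
  have hg0 := hg.continuous
  have hf1 : Continuous (pd3 i f) := (contDiff_pd3 (n := 0) (by simpa using hf) i).continuous
  have hg1 : Continuous (pd3 i g) := (contDiff_pd3 (n := 0) (by simpa using hg) i).continuous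
  exact integral_mul_fderiv_eq_neg_fderiv_mul_of_integrable
    ((hf1.mul hg0).integrable_of_hasCompactSupport hgc.mul_left)
    ((hf0.mul hg1).integrable_of_hasCompactSupport (hasCompactSupport_pd3 hgc i).mul_left)
    ((hf0.mul hg0).integrable_of_hasCompactSupport hgc.mul_left)
    (fun x _ => hf.differentiable one_ne_zero x) (fun x _ => hg.differentiable one_ne_zero x)

theorem integral_mul_pd3_pd3 {f g : E3 → ℝ} (hf : ContDiff ℝ 2 f) (hg : ContDiff ℝ 2 g)
    (hgc : HasCompactSupport g) (i : Fin 3) :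
    ∫ x, f x * pd3 i (pd3 i g) x = ∫ x, pd3 i (pd3 i f) x * g x := by
  have hf1 : ContDiff ℝ 1 (pd3 i f) := contDiff_pd3 (by simpa [one_add_one_eq_two] using hf) i
  have hg1 : ContDiff ℝ 1 (pd3 i g) := contDiff_pd3 (by simpa [one_add_one_eq_two] using hg) i
  rw [integral_mul_pd3 (hf.of_le one_le_two) hg1 (hasCompactSupport_pd3 hgc i),
    integral_mul_pd3 hf1 (hg.of_le one_le_two) hgc, neg_neg]

/-! ### The Newton kernel -/

theorem locallyIntegrable_norm_inv : LocallyIntegrable (fun z : E3 => ‖z‖⁻¹) := by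
  refine locallyIntegrable_of_norm_le_rpow (C := 1) (α := 1) (by simp) (by simp) ?_ ?_
  · refine Filter.Eventually.of_forall fun x => ?_
    simp [Real.rpow_neg_one]
  · exact (measurable_norm.inv).aestronglyMeasurable

/-- The mass of the Laplacian of the regularised Newton kernel. -/
noncomputable def newtonMass : ℝ := ∫ z : E3, 3 * (1 + ‖z‖ ^ 2) ^ (-(5 / 2) : ℝ)

theorem integrable_newtonMass :
    Integrable (fun z : E3 => 3 * (1 + ‖z‖ ^ 2) ^ (-(5 / 2) : ℝ)) := by
  have h := integrable_rpow_neg_one_add_norm_sq (E := E3) (μ := volume) (r := 5)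
    (by simp; norm_num)
  rw [neg_div] at h
  exact h.const_mul 3

theorem newtonMass_pos : 0 < newtonMass := by
  refine (integral_pos_iff_support_of_nonneg (fun z => by positivity) integrable_newtonMass).2 ?_
  have : Function.support (fun z : E3 => 3 * (1 + ‖z‖ ^ 2) ^ (-(5 / 2) : ℝ)) = Set.univ := by
    ext z
    simp only [Function.mem_support, Set.mem_univ, iff_true]
    positivity
  rw [this]
  simp

theorem integral_newton_regularised {ε : ℝ} (hε : 0 < ε) {ψ : E3 → ℝ} (hψ : ContDiff ℝ 2 ψ)
    (hc : HasCompactSupport ψ) :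
    ∫ z, (‖z‖ ^ 2 + ε ^ 2) ^ (-(1 / 2) : ℝ) * ∑ i, pd3 i (pd3 i ψ) z
      = -∫ z : E3, 3 * (1 + ‖z‖ ^ 2) ^ (-(5 / 2) : ℝ) * ψ (ε • z) := by
  have hk : ContDiff ℝ 2 (fun z : E3 => (‖z‖ ^ 2 + ε ^ 2) ^ (-(1 / 2) : ℝ)) :=
    contDiff_norm_sq_add_rpow hε _
  have hψ1 (i) : ContDiff ℝ 1 (pd3 i ψ) := contDiff_pd3 (by simpa [one_add_one_eq_two] using hψ) i
  have hψ2 (i) : Continuous (pd3 i (pd3 i ψ)) :=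
    (contDiff_pd3 (n := 0) (by simpa using hψ1 i) i).continuous
  have hk1 (i) : ContDiff ℝ 1 (pd3 i (fun z : E3 => (‖z‖ ^ 2 + ε ^ 2) ^ (-(1 / 2) : ℝ))) :=
    contDiff_pd3 (by simpa [one_add_one_eq_two] using hk) i
  have hk2 (i) : Continuous
      (pd3 i (pd3 i (fun z : E3 => (‖z‖ ^ 2 + ε ^ 2) ^ (-(1 / 2) : ℝ)))) :=
    (contDiff_pd3 (n := 0) (by simpa using hk1 i) i).continuous
  have h1 : ∫ z, (‖z‖ ^ 2 + ε ^ 2) ^ (-(1 / 2) : ℝ) * ∑ i, pd3 i (pd3 i ψ) z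
      = ∫ z : E3, -(3 * ε ^ 2 * (‖z‖ ^ 2 + ε ^ 2) ^ (-(5 / 2) : ℝ)) * ψ z := by
    simp_rw [Finset.mul_sum, ← sum_pd3_pd3_newton_regularised hε, Finset.sum_mul]
    rw [integral_finsetSum, integral_finsetSum]
    · exact Finset.sum_congr rfl fun i _ => integral_mul_pd3_pd3 hk hψ hc i
    · exact fun i _ => ((hk2 i).mul hψ.continuous).integrable_of_hasCompactSupport hc.mul_left
    · exact fun i _ => (hk.continuous.mul (hψ2 i)).integrable_of_hasCompactSupport
        (hasCompactSupport_pd3 (hasCompactSupport_pd3 hc i) i).mul_left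
  have h2 := Measure.integral_comp_smul (volume : Measure E3)
    (fun z : E3 => (3 * ε ^ 2 * (‖z‖ ^ 2 + ε ^ 2) ^ (-(5 / 2) : ℝ)) * ψ z) ε
  have h3 : ∀ z : E3, 3 * (1 + ‖z‖ ^ 2) ^ (-(5 / 2) : ℝ) * ψ (ε • z)
      = ε ^ 3 * ((3 * ε ^ 2 * (‖ε • z‖ ^ 2 + ε ^ 2) ^ (-(5 / 2) : ℝ)) * ψ (ε • z)) := by
    intro z
    have e1 : ‖ε • z‖ ^ 2 + ε ^ 2 = ε ^ 2 * (1 + ‖z‖ ^ 2) := by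
      rw [norm_smul, Real.norm_of_nonneg hε.le]; ring
    have e2 : (ε ^ 2) ^ (-(5 / 2) : ℝ) = (ε ^ 5)⁻¹ := by
      rw [← Real.rpow_natCast ε 2, ← Real.rpow_mul hε.le, ← Real.rpow_natCast ε 5,
        ← Real.rpow_neg hε.le]
      norm_num
    rw [e1, Real.mul_rpow (by positivity) (by positivity), e2]
    field_simp
  rw [h1]
  simp_rw [h3, neg_mul]
  rw [integral_neg, integral_const_mul, h2]
  have : |(ε ^ Module.finrank ℝ E3)⁻¹| = (ε ^ 3)⁻¹ := by
    rw [abs_of_pos (by positivity)]; simp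
  rw [this, smul_eq_mul, ← mul_assoc, mul_inv_cancel₀ (by positivity), one_mul]

theorem integral_norm_inv_mul_laplacian {ψ : E3 → ℝ} (hψ : ContDiff ℝ 2 ψ)
    (hc : HasCompactSupport ψ) :
    ∫ z, ‖z‖⁻¹ * ∑ i, pd3 i (pd3 i ψ) z = -(newtonMass * ψ 0) := by
  have hψ1 (i) : ContDiff ℝ 1 (pd3 i ψ) := contDiff_pd3 (by simpa [one_add_one_eq_two] using hψ) i
  have hψ2 (i) : Continuous (pd3 i (pd3 i ψ)) :=
    (contDiff_pd3 (n := 0) (by simpa using hψ1 i) i).continuous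
  have hLc : Continuous (fun z => ∑ i, pd3 i (pd3 i ψ) z) := by fun_prop
  have hLs : HasCompactSupport (fun z => ∑ i, pd3 i (pd3 i ψ) z) := by
    refine hc.mono' fun z hz => ?_
    by_contra h
    refine hz (Finset.sum_eq_zero fun i _ => ?_)
    have := (tsupport_fderiv_apply_subset ℝ (f := pd3 i ψ) (EuclideanSpace.single i 1)).trans
      (tsupport_fderiv_apply_subset ℝ (f := ψ) (EuclideanSpace.single i 1))
    exact image_eq_zero_of_notMem_tsupport fun h' => h (this h')
  set u : ℕ → ℝ := fun n => 1 / ((n : ℝ) + 1) with hu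
  have hu0 : Filter.Tendsto u Filter.atTop (nhds 0) := tendsto_one_div_add_atTop_nhds_zero_nat
  have hup (n) : 0 < u n := Nat.one_div_pos_of_nat
  have hae : ∀ᵐ z : E3, z ≠ 0 := by
    simp [ae_iff]
  have L : Filter.Tendsto (fun n => ∫ z : E3, (‖z‖ ^ 2 + u n ^ 2) ^ (-(1 / 2) : ℝ)
      * ∑ i, pd3 i (pd3 i ψ) z) Filter.atTop (nhds (∫ z, ‖z‖⁻¹ * ∑ i, pd3 i (pd3 i ψ) z)) := by
    have key : ∀ z : E3, z ≠ 0 → (‖z‖ ^ 2) ^ (-(1 / 2) : ℝ) = ‖z‖⁻¹ := by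
      intro z hz
      rw [← Real.rpow_natCast, ← Real.rpow_mul (norm_nonneg _)]
      norm_num [Real.rpow_neg_one]
    refine tendsto_integral_of_dominated_convergence
      (fun z => ‖z‖⁻¹ * |∑ i, pd3 i (pd3 i ψ) z|) ?_ ?_ ?_ ?_
    · intro n
      exact ((contDiff_norm_sq_add_rpow (n := 0) (hup n) _).continuous.mul
        hLc).aestronglyMeasurable
    · have := locallyIntegrable_norm_inv.integrable_smul_right_of_hasCompactSupport hLc.abs
        (hLs.comp_left (g := fun x => |x|) abs_zero)
      simpa [mul_comm] using this
    · intro n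
      filter_upwards [hae] with z hz
      rw [norm_mul, Real.norm_of_nonneg (by positivity), Real.norm_eq_abs, ← key z hz]
      have hz' : 0 < ‖z‖ ^ 2 := by positivity
      refine mul_le_mul_of_nonneg_right ?_ (abs_nonneg _)
      exact Real.rpow_le_rpow_of_nonpos hz' (by nlinarith [sq_nonneg (u n)]) (by norm_num)
    · filter_upwards [hae] with z hz
      rw [← key z hz]
      refine Filter.Tendsto.mul_const _ ?_
      have h1 : Filter.Tendsto (fun n => ‖z‖ ^ 2 + u n ^ 2) Filter.atTop (nhds (‖z‖ ^ 2)) := by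
        simpa using (hu0.pow 2).const_add (‖z‖ ^ 2)
      exact h1.rpow_const (Or.inl (by positivity))
  have Rr : Filter.Tendsto (fun n => -∫ z : E3, 3 * (1 + ‖z‖ ^ 2) ^ (-(5 / 2) : ℝ) * ψ (u n • z))
      Filter.atTop (nhds (-(newtonMass * ψ 0))) := by
    refine Filter.Tendsto.neg ?_
    rw [newtonMass, ← integral_mul_const]
    obtain ⟨M, hM⟩ := hψ.continuous.bounded_above_of_compact_support hc
    have hcont : Continuous (fun z : E3 => 3 * (1 + ‖z‖ ^ 2) ^ (-(5 / 2) : ℝ)) := by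
      refine continuous_const.mul (Continuous.rpow_const (by fun_prop) fun z => Or.inl ?_)
      positivity
    refine tendsto_integral_of_dominated_convergence
      (fun z : E3 => 3 * (1 + ‖z‖ ^ 2) ^ (-(5 / 2) : ℝ) * M) ?_
      (integrable_newtonMass.mul_const M) ?_ ?_
    · intro n
      exact (hcont.mul (hψ.continuous.comp (continuous_const_smul _))).aestronglyMeasurable
    · intro n
      refine Filter.Eventually.of_forall fun z => ?_
      rw [norm_mul, Real.norm_of_nonneg (by positivity)]
      gcongr
      exact hM _
    · refine Filter.Eventually.of_forall fun z => ?_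
      refine Filter.Tendsto.const_mul _ ?_
      have h1 : Filter.Tendsto (fun n => u n • z) Filter.atTop (nhds 0) := by
        simpa using hu0.smul_const z
      exact (hψ.continuous.tendsto 0).comp h1
  refine tendsto_nhds_unique L (Rr.congr fun n => ?_)
  exact (integral_newton_regularised (hup n) hψ hc).symm

/-! ### Newton potentials -/

/-- The (unnormalised) Newton potential of `φ`. -/
noncomputable def newtonPot (φ : E3 → ℝ) : E3 → ℝ :=
  convolution (fun z : E3 => ‖z‖⁻¹) φ (ContinuousLinearMap.mul ℝ ℝ) volume

theorem newtonPot_apply (φ : E3 → ℝ) (x : E3) :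
    newtonPot φ x = ∫ z, ‖z‖⁻¹ * φ (x - z) := rfl

theorem contDiff_newtonPot {φ : E3 → ℝ} {n : ℕ∞} (hφ : ContDiff ℝ n φ)
    (hc : HasCompactSupport φ) : ContDiff ℝ n (newtonPot φ) :=
  hc.contDiff_convolution_right _ locallyIntegrable_norm_inv hφ

theorem pd3_newtonPot {φ : E3 → ℝ} (hφ : ContDiff ℝ 1 φ) (hc : HasCompactSupport φ) (i : Fin 3) :
    pd3 i (newtonPot φ) = newtonPot (pd3 i φ) := by
  funext x
  rw [newtonPot, pd3_eq_of_hasFDerivAt (hc.hasFDerivAt_convolution_right _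
    locallyIntegrable_norm_inv hφ x), convolution_precompR_apply _ locallyIntegrable_norm_inv
    (hc.fderiv ℝ) (hφ.continuous_fderiv one_ne_zero)]
  rfl

theorem laplacian_newtonPot {φ : E3 → ℝ} (hφ : ContDiff ℝ 2 φ) (hc : HasCompactSupport φ)
    (x : E3) : ∑ i, pd3 i (pd3 i (newtonPot φ)) x = -(newtonMass * φ x) := by
  have hφ1 (i) : ContDiff ℝ 1 (pd3 i φ) := contDiff_pd3 (by simpa [one_add_one_eq_two] using hφ) i
  have hφ2 (i) : Continuous (pd3 i (pd3 i φ)) :=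
    (contDiff_pd3 (n := 0) (by simpa using hφ1 i) i).continuous
  set ψ : E3 → ℝ := fun z => φ (x - z) with hψdef
  have hψ : ContDiff ℝ 2 ψ := hφ.comp (contDiff_const.sub contDiff_id)
  have hψc : HasCompactSupport ψ := hc.comp_homeomorph (Homeomorph.subLeft x)
  have hneg : ∀ (f : E3 → ℝ) (i : Fin 3) (z : E3), Differentiable ℝ f →
      pd3 i (fun z => f (x - z)) z = -pd3 i f (x - z) := by
    intro f i z hf
    have h1 : HasFDerivAt (fun z : E3 => x - z) (-ContinuousLinearMap.id ℝ E3) z :=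
      (hasFDerivAt_id z).const_sub x
    have h2 : HasFDerivAt (fun z : E3 => f (x - z)) _ z := (hf (x - z)).hasFDerivAt.comp z h1
    rw [pd3_eq_of_hasFDerivAt h2]
    simp [pd3]
  have hp1 (i) : pd3 i ψ = fun z => -pd3 i φ (x - z) := by
    funext z
    exact hneg φ i z (hφ.differentiable two_ne_zero)
  have hp2 (i) (z) : pd3 i (pd3 i ψ) z = pd3 i (pd3 i φ) (x - z) := by
    have h := hneg (fun z => -pd3 i φ z) i z ((hφ1 i).differentiable one_ne_zero).neg
    rw [hp1, h]
    have : pd3 i (fun z => -pd3 i φ z) (x - z) = -pd3 i (pd3 i φ) (x - z) := by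
      rw [pd3, pd3, fderiv_fun_neg]; simp
    rw [this, neg_neg]
  have h_green := integral_norm_inv_mul_laplacian hψ hψc
  have h0 : ψ 0 = φ x := by simp [hψdef]
  rw [h0] at h_green
  rw [← h_green]
  simp_rw [hp2, Finset.mul_sum]
  rw [integral_finsetSum]
  · refine Finset.sum_congr rfl fun i _ => ?_
    rw [pd3_newtonPot (hφ.of_le one_le_two) hc, pd3_newtonPot (hφ1 i) (hasCompactSupport_pd3 hc i)]
    rfl
  · intro i _
    have h := (hasCompactSupport_pd3 (hasCompactSupport_pd3 hc i) i).comp_homeomorph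
      (Homeomorph.subLeft x)
    have := locallyIntegrable_norm_inv.integrable_smul_right_of_hasCompactSupport
      ((hφ2 i).comp (Homeomorph.subLeft x).continuous) h
    simpa [mul_comm] using this

/-! ### Positively homogeneous functions -/

section Homogeneous

variable {F : Type*} [NormedAddCommGroup F] [NormedSpace ℝ F]

theorem isOpen_ne_zero : IsOpen {x : E3 | x ≠ 0} := isOpen_ne

/-- `V` is positively homogeneous of degree `-m` away from the origin. -/
def HomogNeg (m : ℕ) (V : E3 → F) : Prop :=
  ∀ s : ℝ, 0 < s → ∀ x : E3, x ≠ 0 → V (s • x) = (s ^ m)⁻¹ • V x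

theorem HomogNeg.bound {m : ℕ} {V : E3 → F} (h : HomogNeg m V)
    (hc : ContinuousOn V {x | x ≠ 0}) :
    ∃ C, 0 ≤ C ∧ ∀ x : E3, x ≠ 0 → ‖V x‖ ≤ C * (‖x‖ ^ m)⁻¹ := by
  obtain ⟨C, hC⟩ := (isCompact_sphere (0 : E3) 1).exists_bound_of_continuousOn
    (hc.mono fun x hx => by
      rintro rfl
      simp at hx)
  refine ⟨max C 0, le_max_right _ _, fun x hx => ?_⟩
  have hx' : 0 < ‖x‖ := norm_pos_iff.2 hx
  have hu : ‖x‖⁻¹ • x ≠ 0 := smul_ne_zero (inv_ne_zero hx'.ne') hx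
  have h1 := h ‖x‖ hx' _ hu
  rw [smul_smul, mul_inv_cancel₀ hx'.ne', one_smul] at h1
  rw [h1, norm_smul, Real.norm_of_nonneg (by positivity), mul_comm]
  gcongr
  refine (hC _ ?_).trans (le_max_left _ _)
  simp [norm_smul, hx'.ne']

theorem HomogNeg.fderiv {m : ℕ} {V : E3 → F} (h : HomogNeg m V) :
    HomogNeg (m + 1) (_root_.fderiv ℝ V) := by
  intro s hs x hx
  have h1 : _root_.fderiv ℝ (fun x => V (s • x)) x = _root_.fderiv ℝ (fun x => (s ^ m)⁻¹ • V x) x :=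
    Filter.EventuallyEq.fderiv_eq <| by
      filter_upwards [isOpen_ne_zero.mem_nhds hx] with y hy using h s hs y hy
  rw [fderiv_comp_smul] at h1
  have h3 := congrFun (fderiv_const_smul_field (𝕜 := ℝ) (f := V) (s ^ m)⁻¹) x
  rw [Pi.smul_apply] at h3
  replace h1 := h1.trans h3
  have h2 := congrArg (fun T => s⁻¹ • T) h1
  simp only [smul_smul, inv_mul_cancel₀ hs.ne', one_smul] at h2
  rw [h2, pow_succ, mul_inv, mul_comm]

theorem HomogNeg.pd3 {m : ℕ} {V : E3 → ℝ} (h : HomogNeg m V) (i : Fin 3) :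
    HomogNeg (m + 1) (pd3 i V) := by
  intro s hs x hx
  simp [_root_.pd3, h.fderiv s hs x hx]

end Homogeneous

/-! ### Decay of potentials -/

section Decay

variable {F : Type*} [NormedAddCommGroup F] [NormedSpace ℝ F]

/-- The potential of the density `φ` with kernel `V`. -/
noncomputable def potential (φ : E3 → ℝ) (V : E3 → F) (x : E3) : F := ∫ y, φ y • V (x - y)

theorem sub_ne_zero_of_norm_lt {R : ℝ} {x y : E3} (hx : R < ‖x‖)
    (hy : y ∈ Metric.closedBall (0 : E3) R) : x - y ≠ 0 := by
  intro h
  rw [sub_eq_zero] at h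
  rw [mem_closedBall_zero_iff, ← h] at hy
  linarith

theorem continuousOn_potential_integrand {φ : E3 → ℝ} (hφ : Continuous φ) {V : E3 → F}
    (hV : ContinuousOn V {x | x ≠ 0}) {R : ℝ} {x : E3} (hx : R < ‖x‖) :
    ContinuousOn (fun y => φ y • V (x - y)) (Metric.closedBall 0 R) :=
  hφ.continuousOn.smul (hV.comp (by fun_prop) fun _ hy => sub_ne_zero_of_norm_lt hx hy)

theorem potential_eq_setIntegral {φ : E3 → ℝ} {R : ℝ} (hR : ∀ y, R < ‖y‖ → φ y = 0)
    (V : E3 → F) (x : E3) :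
    potential φ V x = ∫ y in Metric.closedBall (0 : E3) R, φ y • V (x - y) := by
  rw [potential, setIntegral_eq_integral_of_forall_compl_eq_zero]
  intro y hy
  rw [hR y (by simpa using hy), zero_smul]

theorem hasFDerivAt_potential {φ : E3 → ℝ} (hφ : Continuous φ) {R : ℝ}
    (hR : ∀ y, R < ‖y‖ → φ y = 0) {V : E3 → F} (hV : ContDiffOn ℝ 1 V {x | x ≠ 0}) {m : ℕ} {C : ℝ}
    (hb : ∀ x : E3, x ≠ 0 → ‖fderiv ℝ V x‖ ≤ C * (‖x‖ ^ m)⁻¹) {x : E3} (hx : R < ‖x‖) :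
    HasFDerivAt (potential φ V) (potential φ (fderiv ℝ V) x) x := by
  have hV0 := hV.continuousOn
  have hV1 : ContinuousOn (fderiv ℝ V) {x | x ≠ 0} :=
    hV.continuousOn_fderiv_of_isOpen isOpen_ne_zero le_rfl
  have hVd : ∀ z : E3, z ≠ 0 → HasFDerivAt V (fderiv ℝ V z) z := fun z hz =>
    ((hV.differentiableOn one_ne_zero).differentiableAt (isOpen_ne_zero.mem_nhds hz)).hasFDerivAt
  have e : potential φ V = fun x => ∫ y in Metric.closedBall (0 : E3) R, φ y • V (x - y) :=
    funext fun x => potential_eq_setIntegral hR V x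
  rw [e, potential_eq_setIntegral hR]
  obtain ⟨δ, hδ, hδx⟩ : ∃ δ, 0 < δ ∧ R + δ < ‖x‖ := ⟨(‖x‖ - R) / 2, by linarith, by linarith⟩
  have hs : {x' : E3 | R + δ < ‖x'‖} ∈ nhds x :=
    (isOpen_lt continuous_const continuous_norm).mem_nhds hδx
  refine hasFDerivAt_integral_of_dominated_of_fderiv_le (F' := fun x y => φ y • fderiv ℝ V (x - y))
    (bound := fun y => |φ y| * (|C| * (δ ^ m)⁻¹)) hs ?_ ?_ ?_ ?_ ?_ ?_
  · filter_upwards [hs] with x' hx'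
    exact (continuousOn_potential_integrand hφ hV0
      (lt_trans (by linarith) hx')).aestronglyMeasurable Metric.isClosed_closedBall.measurableSet
  · exact (continuousOn_potential_integrand hφ hV0 hx).integrableOn_compact
      (isCompact_closedBall _ _)
  · exact (continuousOn_potential_integrand hφ hV1 hx).aestronglyMeasurable
      Metric.isClosed_closedBall.measurableSet
  · refine (ae_restrict_iff' Metric.isClosed_closedBall.measurableSet).2
      (Filter.Eventually.of_forall fun y hy x' hx' => ?_)
    have hne : x' - y ≠ 0 := sub_ne_zero_of_norm_lt (lt_trans (by linarith) hx') hy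
    have hlow : δ ≤ ‖x' - y‖ := by
      have h1 := norm_sub_norm_le x' y
      have h2 : ‖y‖ ≤ R := by simpa using hy
      have h3 : R + δ < ‖x'‖ := hx'
      linarith
    rw [norm_smul, Real.norm_eq_abs]
    gcongr
    refine (hb _ hne).trans ?_
    gcongr
    exact le_abs_self C
  · exact (hφ.abs.continuousOn.mul continuousOn_const).integrableOn_compact
      (isCompact_closedBall _ _)
  · refine (ae_restrict_iff' Metric.isClosed_closedBall.measurableSet).2
      (Filter.Eventually.of_forall fun y hy x' hx' => ?_)
    have hne : x' - y ≠ 0 := sub_ne_zero_of_norm_lt (lt_trans (by linarith) hx') hy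
    exact ((hasFDerivAt_comp_sub y).2 (hVd _ hne)).const_smul (φ y)

theorem norm_potential_le {φ : E3 → ℝ} (hφ : Continuous φ) {R : ℝ} (hR0 : 0 < R)
    (hR : ∀ y, R < ‖y‖ → φ y = 0) {V : E3 → F} {m : ℕ} {C : ℝ}
    (hb : ∀ x : E3, x ≠ 0 → ‖V x‖ ≤ C * (‖x‖ ^ m)⁻¹) :
    ∃ C', ∀ x : E3, 2 * R < ‖x‖ → ‖x‖ ^ m * ‖potential φ V x‖ ≤ C' := by
  refine ⟨∫ y in Metric.closedBall (0 : E3) R, |φ y| * (|C| * 2 ^ m), fun x hx => ?_⟩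
  have hx0 : 0 < ‖x‖ := by linarith
  have hn : ‖x‖ ^ m * ‖potential φ V x‖ = ‖‖x‖ ^ m • potential φ V x‖ := by
    rw [norm_smul, norm_pow, norm_norm]
  rw [hn, potential_eq_setIntegral hR, ← integral_smul]
  refine norm_integral_le_of_norm_le ((hφ.abs.continuousOn.mul
    continuousOn_const).integrableOn_compact (isCompact_closedBall _ _)) ?_
  refine (ae_restrict_iff' Metric.isClosed_closedBall.measurableSet).2
      (Filter.Eventually.of_forall fun y hy => ?_)
  have hne : x - y ≠ 0 := sub_ne_zero_of_norm_lt (by linarith : R < ‖x‖) hy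
  have hlow : ‖x‖ / 2 ≤ ‖x - y‖ := by
    have h1 := norm_sub_norm_le x y
    have h2 : ‖y‖ ≤ R := by simpa using hy
    linarith
  have h3 : ‖V (x - y)‖ ≤ |C| * ((‖x‖ / 2) ^ m)⁻¹ := by
    refine (hb _ hne).trans ?_
    gcongr
    exact le_abs_self C
  have h4 : ‖x‖ ^ m * ((‖x‖ / 2) ^ m)⁻¹ = 2 ^ m := by
    rw [div_pow]; field_simp
  rw [norm_smul, norm_smul, norm_pow, norm_norm, Real.norm_eq_abs]
  calc ‖x‖ ^ m * (|φ y| * ‖V (x - y)‖)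
      ≤ ‖x‖ ^ m * (|φ y| * (|C| * ((‖x‖ / 2) ^ m)⁻¹)) := by gcongr
    _ = |φ y| * (|C| * (‖x‖ ^ m * ((‖x‖ / 2) ^ m)⁻¹)) := by ring
    _ = _ := by rw [h4]

theorem bounded_of_decay {V : E3 → F} (hV : Continuous V) {m : ℕ} {C R : ℝ}
    (hb : ∀ x : E3, R < ‖x‖ → ‖x‖ ^ m * ‖V x‖ ≤ C) :
    ∃ C', ∀ x : E3, ‖V x‖ ≤ C' ∧ ‖x‖ ^ m * ‖V x‖ ≤ C' := by
  obtain ⟨M, hM⟩ := (isCompact_closedBall (0 : E3) (max R 1)).exists_bound_of_continuousOn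
    (f := fun x => (1 + ‖x‖ ^ m) • V x) (by fun_prop)
  have key : ∀ x : E3, (1 + ‖x‖ ^ m) * ‖V x‖ ≤ max M (2 * |C|) := by
    intro x
    by_cases hx : ‖x‖ ≤ max R 1
    · have := hM x (by simpa using hx)
      rw [norm_smul, Real.norm_of_nonneg (by positivity)] at this
      exact this.trans (le_max_left _ _)
    · push Not at hx
      have h1 := hb x ((le_max_left _ _).trans_lt hx)
      have h2 : 1 ≤ ‖x‖ ^ m := one_le_pow₀ ((le_max_right R 1).trans hx.le)
      have h3 : ‖V x‖ ≤ ‖x‖ ^ m * ‖V x‖ := le_mul_of_one_le_left (norm_nonneg _) h2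
      refine le_trans ?_ (le_max_right _ _)
      have := le_abs_self C
      linarith
  refine ⟨max M (2 * |C|), fun x => ⟨?_, ?_⟩⟩
  · refine le_trans ?_ (key x)
    have : 0 ≤ ‖x‖ ^ m * ‖V x‖ := by positivity
    linarith
  · refine le_trans ?_ (key x)
    have : 0 ≤ ‖V x‖ := by positivity
    linarith

/-- `V` decays at infinity and vanishes at the origin fast enough for
`∫ e^{jt} V(e^t x) dt` to converge absolutely. -/
def DilDecay (j : ℕ) (V : E3 → F) : Prop :=
  ∃ C, ∀ z : E3, ‖z‖ ^ j * ‖V z‖ * ‖z‖ ≤ C ∧ ‖z‖ ^ j * ‖V z‖ ≤ C * ‖z‖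

omit [NormedSpace ℝ F] in
theorem DilDecay.mono {F' : Type*} [NormedAddCommGroup F'] {j : ℕ} {V : E3 → F} {V' : E3 → F'}
    (h : DilDecay j V) (hle : ∀ z, ‖V' z‖ ≤ ‖V z‖) : DilDecay j V' := by
  obtain ⟨C, hC⟩ := h
  refine ⟨C, fun z => ⟨le_trans ?_ (hC z).1, le_trans ?_ (hC z).2⟩⟩
  · gcongr; exact hle z
  · gcongr; exact hle z

end Decay

theorem homogNeg_norm_inv : HomogNeg 1 (fun z : E3 => ‖z‖⁻¹) := by
  intro s hs x _
  simp [norm_smul, abs_of_pos hs]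
  ring

theorem contDiffOn_norm_inv {n : WithTop ℕ∞} : ContDiffOn ℝ n (fun z : E3 => ‖z‖⁻¹) {x | x ≠ 0} :=
  fun _ hx => ((contDiffAt_norm ℝ hx).inv (norm_ne_zero_iff.2 hx)).contDiffWithinAt

theorem newtonPot_eq_potential (φ : E3 → ℝ) :
    newtonPot φ = potential φ (fun z => ‖z‖⁻¹) := by
  funext x
  rw [newtonPot, convolution_eq_swap, potential]
  simp [mul_comm]

theorem dilDecay_newtonPot {φ : E3 → ℝ} (hφ : ContDiff ℝ 2 φ) (hc : HasCompactSupport φ)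
    (h0 : newtonPot φ 0 = 0) :
    DilDecay 0 (newtonPot φ) ∧ DilDecay 1 (fderiv ℝ (newtonPot φ)) ∧
      DilDecay 2 (fderiv ℝ (fderiv ℝ (newtonPot φ))) := by
  obtain ⟨R, hR0, hR⟩ : ∃ R, 0 < R ∧ ∀ y, R < ‖y‖ → φ y = 0 := by
    obtain ⟨R, hR0, hR⟩ := hc.isCompact.isBounded.exists_pos_norm_le
    refine ⟨R, hR0, fun y hy => image_eq_zero_of_notMem_tsupport fun h => ?_⟩
    linarith [hR y h]
  have hw : ContDiff ℝ 2 (newtonPot φ) := contDiff_newtonPot (n := 2) hφ hc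
  have hw1 : ContDiff ℝ 1 (fderiv ℝ (newtonPot φ)) :=
    hw.fderiv_right (by simp [one_add_one_eq_two])
  have hw2 : Continuous (fderiv ℝ (fderiv ℝ (newtonPot φ))) := hw1.continuous_fderiv one_ne_zero
  set k : E3 → ℝ := fun z => ‖z‖⁻¹ with hk
  have hk0 : ContDiffOn ℝ 2 k {x | x ≠ 0} := contDiffOn_norm_inv
  have hk1 : ContDiffOn ℝ 1 (fderiv ℝ k) {x | x ≠ 0} :=
    hk0.fderiv_of_isOpen isOpen_ne_zero (by simp [one_add_one_eq_two])
  have hk2 : ContinuousOn (fderiv ℝ (fderiv ℝ k)) {x | x ≠ 0} :=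
    hk1.continuousOn_fderiv_of_isOpen isOpen_ne_zero le_rfl
  obtain ⟨C0, -, hC0⟩ := homogNeg_norm_inv.bound hk0.continuousOn
  obtain ⟨C1, -, hC1⟩ := homogNeg_norm_inv.fderiv.bound hk1.continuousOn
  obtain ⟨C2, -, hC2⟩ := homogNeg_norm_inv.fderiv.fderiv.bound hk2
  have e1 : ∀ x : E3, R < ‖x‖ → fderiv ℝ (newtonPot φ) x = potential φ (fderiv ℝ k) x := by
    intro x hx
    rw [newtonPot_eq_potential]
    exact (hasFDerivAt_potential hφ.continuous hR (hk0.of_le one_le_two) hC1 hx).fderiv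
  have e2 : ∀ x : E3, R < ‖x‖ →
      fderiv ℝ (fderiv ℝ (newtonPot φ)) x = potential φ (fderiv ℝ (fderiv ℝ k)) x := by
    intro x hx
    have : fderiv ℝ (newtonPot φ) =ᶠ[nhds x] potential φ (fderiv ℝ k) := by
      filter_upwards [(isOpen_lt continuous_const continuous_norm).mem_nhds hx] with y hy
        using e1 y hy
    rw [this.fderiv_eq]
    exact (hasFDerivAt_potential hφ.continuous hR hk1 hC2 hx).fderiv
  obtain ⟨B0, hB0⟩ := norm_potential_le hφ.continuous hR0 hR hC0
  obtain ⟨B1, hB1⟩ := norm_potential_le hφ.continuous hR0 hR hC1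
  obtain ⟨B2, hB2⟩ := norm_potential_le hφ.continuous hR0 hR hC2
  obtain ⟨D0, hD0⟩ := bounded_of_decay hw.continuous (m := 1) (C := B0) (R := 2 * R)
    fun x hx => by rw [newtonPot_eq_potential]; exact hB0 x hx
  obtain ⟨D1, hD1⟩ := bounded_of_decay hw1.continuous (m := 2) (C := B1) (R := 2 * R)
    fun x hx => by rw [e1 x (by linarith)]; exact hB1 x hx
  obtain ⟨D2, hD2⟩ := bounded_of_decay
    (V := fderiv ℝ (fderiv ℝ (newtonPot φ))) hw2 (m := 3) (C := B2) (R := 2 * R)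
    fun x hx => by rw [e2 x (by linarith)]; exact hB2 x hx
  have hlip : ∀ z : E3, ‖newtonPot φ z‖ ≤ D1 * ‖z‖ := by
    intro z
    have := convex_univ.norm_image_sub_le_of_norm_fderiv_le (𝕜 := ℝ) (f := newtonPot φ) (C := D1)
      (fun x _ => hw.differentiable two_ne_zero x) (fun x _ => (hD1 x).1)
      (Set.mem_univ (0 : E3)) (Set.mem_univ z)
    simpa [h0] using this
  refine ⟨⟨max D0 D1, fun z => ⟨?_, ?_⟩⟩, ⟨D1, fun z => ⟨?_, ?_⟩⟩, ⟨2 * D2, fun z => ⟨?_, ?_⟩⟩⟩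
  · refine le_trans ?_ ((hD0 z).2.trans (le_max_left _ _))
    simp [mul_comm]
  · rw [pow_zero, one_mul]
    refine (hlip z).trans ?_
    gcongr
    exact le_max_right _ _
  · refine le_trans (le_of_eq ?_) (hD1 z).2
    ring
  · rw [pow_one, mul_comm]
    gcongr
    exact (hD1 z).1
  · refine le_trans (le_of_eq ?_) ((hD2 z).2.trans ?_)
    · ring
    · have h1 : 0 ≤ D2 := le_trans (by positivity) (hD2 z).1
      linarith
  · have h1 : ‖z‖ * ‖fderiv ℝ (fderiv ℝ (newtonPot φ)) z‖ ≤ 2 * D2 := by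
      have h2 : ‖z‖ ≤ 1 + ‖z‖ ^ 3 := by
        nlinarith [norm_nonneg z, sq_nonneg (‖z‖ - 1), mul_nonneg (norm_nonneg z)
          (sq_nonneg (‖z‖ - 1))]
      calc _ ≤ (1 + ‖z‖ ^ 3) * ‖fderiv ℝ (fderiv ℝ (newtonPot φ)) z‖ := by gcongr
        _ ≤ 2 * D2 := by
          have := hD2 z
          linarith
    calc _ = (‖z‖ * ‖fderiv ℝ (fderiv ℝ (newtonPot φ)) z‖) * ‖z‖ := by ring
      _ ≤ _ := by gcongr

/-! ### Averaging over dilations -/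

theorem integrable_exp_neg_abs : Integrable (fun t : ℝ => Real.exp (-|t|)) := by
  have h1 : IntegrableOn (fun t : ℝ => Real.exp (-|t|)) (Set.Iic 0) :=
    (integrableOn_exp_Iic 0).congr_fun (fun t ht => by
      rw [abs_of_nonpos (Set.mem_Iic.1 ht), neg_neg]) measurableSet_Iic
  have h2 : IntegrableOn (fun t : ℝ => Real.exp (-|t|)) (Set.Ioi 0) :=
    (integrableOn_exp_neg_Ioi 0).congr_fun (fun t ht => by
      rw [abs_of_pos (Set.mem_Ioi.1 ht)]) measurableSet_Ioi
  have h := h1.union h2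
  rwa [Set.Iic_union_Ioi, integrableOn_univ] at h

section Dilation

variable {F : Type*} [NormedAddCommGroup F] [NormedSpace ℝ F]

/-- The dilation average `∫ e^{jt} V(e^t x) dt`. -/
noncomputable def dilInt (j : ℕ) (V : E3 → F) (x : E3) : F :=
  ∫ t : ℝ, Real.exp t ^ j • V (Real.exp t • x)

theorem DilDecay.exists_bound {j : ℕ} {V : E3 → F} (h : DilDecay j V) {a b : ℝ} (ha : 0 < a) :
    ∃ C, ∀ x : E3, a < ‖x‖ → ‖x‖ < b → ∀ t : ℝ,
      ‖Real.exp t ^ j • V (Real.exp t • x)‖ ≤ C * Real.exp (-|t|) := by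
  obtain ⟨C, hC⟩ := h
  refine ⟨|C| * (a ^ j)⁻¹ * (a⁻¹ + b), fun x hxa hxb t => ?_⟩
  have hx : 0 < ‖x‖ := ha.trans hxa
  have hb : 0 < b := hx.trans hxb
  have he := Real.exp_pos t
  obtain ⟨h1, h2⟩ := hC (Real.exp t • x)
  have hn : ‖Real.exp t • x‖ = Real.exp t * ‖x‖ := by
    rw [norm_smul, Real.norm_of_nonneg he.le]
  set q := ‖Real.exp t • x‖ ^ j * ‖V (Real.exp t • x)‖ with hq
  have hq0 : 0 ≤ q := by positivity
  have e1 : ‖Real.exp t ^ j • V (Real.exp t • x)‖ = q * (‖x‖ ^ j)⁻¹ := by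
    rw [norm_smul, norm_pow, Real.norm_of_nonneg he.le, hq, hn, mul_pow]
    field_simp
  have hqle : q ≤ |C| * (a⁻¹ + b) * Real.exp (-|t|) := by
    have hCa := le_abs_self C
    have hCn := abs_nonneg C
    rw [hn] at h1 h2
    rcases le_total 0 t with ht | ht
    · rw [abs_of_nonneg ht, Real.exp_neg]
      have h3 : q * (Real.exp t * a) ≤ |C| :=
        (mul_le_mul_of_nonneg_left (by gcongr) hq0).trans (h1.trans hCa)
      have h4 : q ≤ |C| * a⁻¹ * (Real.exp t)⁻¹ := by
        rw [mul_assoc, ← mul_inv, ← div_eq_mul_inv, le_div_iff₀ (by positivity)]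
        linarith
      refine h4.trans ?_
      gcongr
      linarith
    · rw [abs_of_nonpos ht, neg_neg]
      calc q ≤ C * (Real.exp t * ‖x‖) := h2
        _ ≤ |C| * (Real.exp t * b) := by gcongr
        _ = |C| * b * Real.exp t := by ring
        _ ≤ _ := by
          gcongr
          linarith [inv_pos.2 ha]
  rw [e1]
  calc q * (‖x‖ ^ j)⁻¹ ≤ (|C| * (a⁻¹ + b) * Real.exp (-|t|)) * (a ^ j)⁻¹ := by gcongr
    _ = _ := by ring

theorem continuous_dil_integrand {j : ℕ} {V : E3 → F} (hV : Continuous V) (x : E3) :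
    Continuous (fun t : ℝ => Real.exp t ^ j • V (Real.exp t • x)) := by fun_prop

theorem DilDecay.integrable {j : ℕ} {V : E3 → F} (h : DilDecay j V) (hV : Continuous V)
    {x : E3} (hx : x ≠ 0) : Integrable (fun t : ℝ => Real.exp t ^ j • V (Real.exp t • x)) := by
  have hx' : 0 < ‖x‖ := norm_pos_iff.2 hx
  obtain ⟨C, hC⟩ := h.exists_bound (a := ‖x‖ / 2) (b := 2 * ‖x‖) (by positivity)
  exact (integrable_exp_neg_abs.const_mul C).mono'
    (continuous_dil_integrand hV x).aestronglyMeasurable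
    (Filter.Eventually.of_forall fun t => hC x (by linarith) (by linarith) t)

theorem annulus_mem_nhds {x : E3} (hx : x ≠ 0) :
    {y : E3 | ‖x‖ / 2 < ‖y‖ ∧ ‖y‖ < 2 * ‖x‖} ∈ nhds x := by
  have hx' : 0 < ‖x‖ := norm_pos_iff.2 hx
  refine ((isOpen_lt continuous_const continuous_norm).inter
    (isOpen_lt continuous_norm continuous_const)).mem_nhds ⟨?_, ?_⟩
  · change ‖x‖ / 2 < ‖x‖
    linarith
  · change ‖x‖ < 2 * ‖x‖
    linarith

theorem hasFDerivAt_dilInt {j : ℕ} {V : E3 → F} (hV : ContDiff ℝ 1 V) (h0 : DilDecay j V)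
    (h1 : DilDecay (j + 1) (fderiv ℝ V)) {x : E3} (hx : x ≠ 0) :
    HasFDerivAt (dilInt j V) (dilInt (j + 1) (fderiv ℝ V) x) x := by
  have hx' : 0 < ‖x‖ := norm_pos_iff.2 hx
  have hV1 := hV.continuous_fderiv one_ne_zero
  obtain ⟨C, hC⟩ := h1.exists_bound (a := ‖x‖ / 2) (b := 2 * ‖x‖) (by positivity)
  refine hasFDerivAt_integral_of_dominated_of_fderiv_le
    (F := fun x t => Real.exp t ^ j • V (Real.exp t • x))
    (F' := fun x t => Real.exp t ^ (j + 1) • fderiv ℝ V (Real.exp t • x))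
    (bound := fun t => C * Real.exp (-|t|)) (annulus_mem_nhds hx)
    (Filter.Eventually.of_forall fun y => (continuous_dil_integrand hV.continuous
      y).aestronglyMeasurable)
    (h0.integrable hV.continuous hx) (continuous_dil_integrand hV1 x).aestronglyMeasurable
    (Filter.Eventually.of_forall fun t y hy => hC y hy.1 hy.2 t)
    (integrable_exp_neg_abs.const_mul C) (Filter.Eventually.of_forall fun t y _ => ?_)
  have hs : HasFDerivAt (fun y : E3 => Real.exp t • y)
      (Real.exp t • ContinuousLinearMap.id ℝ E3) y := (hasFDerivAt_id y).fun_const_smul _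
  have hc := ((hV.differentiable one_ne_zero (Real.exp t • y)).hasFDerivAt.comp y hs).const_smul
    (Real.exp t ^ j)
  refine hc.congr_fderiv ?_
  ext v
  simp [pow_succ, smul_smul]

theorem continuousOn_dilInt {j : ℕ} {V : E3 → F} (hV : Continuous V) (h0 : DilDecay j V) :
    ContinuousOn (dilInt j V) {x | x ≠ 0} := by
  intro x hx
  have hx' : 0 < ‖x‖ := norm_pos_iff.2 hx
  obtain ⟨C, hC⟩ := h0.exists_bound (a := ‖x‖ / 2) (b := 2 * ‖x‖) (by positivity)
  refine ContinuousAt.continuousWithinAt ?_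
  refine continuousAt_of_dominated (bound := fun t => C * Real.exp (-|t|))
    (Filter.Eventually.of_forall fun y => (continuous_dil_integrand hV y).aestronglyMeasurable)
    ?_ (integrable_exp_neg_abs.const_mul C) (Filter.Eventually.of_forall fun t => ?_)
  · filter_upwards [annulus_mem_nhds hx] with y hy
    exact Filter.Eventually.of_forall fun t => hC y hy.1 hy.2 t
  · exact Continuous.continuousAt (by fun_prop)

theorem contDiffOn_dilInt {V : E3 → F} (hV : ContDiff ℝ 2 V) (h0 : DilDecay 0 V)
    (h1 : DilDecay 1 (fderiv ℝ V)) (h2 : DilDecay 2 (fderiv ℝ (fderiv ℝ V))) :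
    ContDiffOn ℝ 2 (dilInt 0 V) {x | x ≠ 0} := by
  have hV1 : ContDiff ℝ 1 (fderiv ℝ V) := hV.fderiv_right (by simp [one_add_one_eq_two])
  have d0 : ∀ x : E3, x ≠ 0 → HasFDerivAt (dilInt 0 V) (dilInt 1 (fderiv ℝ V) x) x :=
    fun x hx => hasFDerivAt_dilInt (hV.of_le one_le_two) h0 h1 hx
  have d1 : ∀ x : E3, x ≠ 0 → HasFDerivAt (dilInt 1 (fderiv ℝ V))
      (dilInt 2 (fderiv ℝ (fderiv ℝ V)) x) x :=
    fun x hx => hasFDerivAt_dilInt hV1 h1 h2 hx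
  have c1 : ContDiffOn ℝ 1 (dilInt 1 (fderiv ℝ V)) {x | x ≠ 0} := by
    rw [← zero_add (1 : WithTop ℕ∞), contDiffOn_succ_iff_fderiv_of_isOpen isOpen_ne_zero]
    refine ⟨fun x hx => (d1 x hx).differentiableAt.differentiableWithinAt, by simp, ?_⟩
    rw [contDiffOn_zero]
    exact (continuousOn_dilInt (hV1.continuous_fderiv one_ne_zero) h2).congr
      fun x hx => (d1 x hx).fderiv
  have h : ContDiffOn ℝ (1 + 1) (dilInt 0 V) {x | x ≠ 0} :=
    (contDiffOn_succ_iff_fderiv_of_isOpen isOpen_ne_zero).2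
      ⟨fun x hx => (d0 x hx).differentiableAt.differentiableWithinAt, by simp,
        c1.congr fun x hx => (d0 x hx).fderiv⟩
  rwa [one_add_one_eq_two] at h

theorem dilInt_zero_smul (V : E3 → F) {s : ℝ} (hs : 0 < s) (x : E3) :
    dilInt 0 V (s • x) = dilInt 0 V x := by
  have := integral_add_right_eq_self (μ := volume)
    (fun t : ℝ => Real.exp t ^ 0 • V (Real.exp t • x)) (Real.log s)
  rw [dilInt, dilInt, ← this]
  simp [Real.exp_add, Real.exp_log hs, smul_smul]

end Dilation

theorem norm_pd3_le {f : E3 → ℝ} (i : Fin 3) (z : E3) : ‖pd3 i f z‖ ≤ ‖fderiv ℝ f z‖ := by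
  simpa [pd3] using (fderiv ℝ f z).le_opNorm (EuclideanSpace.single i 1)

theorem pd3_dilInt {j : ℕ} {V : E3 → ℝ} (hV : ContDiff ℝ 1 V) (h0 : DilDecay j V)
    (h1 : DilDecay (j + 1) (fderiv ℝ V)) {x : E3} (hx : x ≠ 0) (i : Fin 3) :
    pd3 i (dilInt j V) x = dilInt (j + 1) (pd3 i V) x := by
  rw [pd3_eq_of_hasFDerivAt (hasFDerivAt_dilInt hV h0 h1 hx), dilInt,
    ContinuousLinearMap.integral_apply (h1.integrable (hV.continuous_fderiv one_ne_zero) hx)]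
  rfl

theorem pd3_congr_of_eqOn {f g : E3 → ℝ} (h : ∀ x : E3, x ≠ 0 → f x = g x) {x : E3} (hx : x ≠ 0)
    (i : Fin 3) : pd3 i f x = pd3 i g x := by
  have : f =ᶠ[nhds x] g := by
    filter_upwards [isOpen_ne_zero.mem_nhds hx] with y hy using h y hy
  rw [pd3, pd3, this.fderiv_eq]

theorem laplacian_dilInt {V : E3 → ℝ} (hV : ContDiff ℝ 2 V) (h0 : DilDecay 0 V)
    (h1 : DilDecay 1 (fderiv ℝ V)) (h2 : DilDecay 2 (fderiv ℝ (fderiv ℝ V))) {x : E3}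
    (hx : x ≠ 0) :
    ∑ i, pd3 i (pd3 i (dilInt 0 V)) x = dilInt 2 (fun z => ∑ i, pd3 i (pd3 i V) z) x := by
  have hV1 : ContDiff ℝ 1 (fderiv ℝ V) := hV.fderiv_right (by simp [one_add_one_eq_two])
  have hp (i) : ContDiff ℝ 1 (pd3 i V) := contDiff_pd3 (by simpa [one_add_one_eq_two] using hV) i
  have hp2 (i) : Continuous (pd3 i (pd3 i V)) :=
    (contDiff_pd3 (n := 0) (by simpa using hp i) i).continuous
  have hp1d (i) : DilDecay 1 (pd3 i V) := h1.mono (norm_pd3_le i)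
  have hp2d (i) : DilDecay 2 (fderiv ℝ (pd3 i V)) := by
    refine h2.mono fun z => ?_
    have hd := (hV1.differentiable one_ne_zero z).hasFDerivAt
    have he : HasFDerivAt (pd3 i V) _ z := hd.clm_apply
      (hasFDerivAt_const (EuclideanSpace.single i (1 : ℝ)) z)
    rw [he.fderiv]
    refine ContinuousLinearMap.opNorm_le_bound _ (by positivity) fun v => ?_
    simpa using ((fderiv ℝ (fderiv ℝ V) z).le_opNorm₂ v (EuclideanSpace.single i (1 : ℝ)))
  have hp3d (i) : DilDecay 2 (pd3 i (pd3 i V)) := (hp2d i).mono (norm_pd3_le i)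
  rw [dilInt]
  simp_rw [Finset.smul_sum]
  rw [integral_finsetSum _ fun i _ => (hp3d i).integrable (hp2 i) hx]
  refine Finset.sum_congr rfl fun i _ => ?_
  rw [pd3_congr_of_eqOn (fun y hy => pd3_dilInt (hV.of_le one_le_two) h0 h1 hy i) hx,
    pd3_dilInt (hp i) (hp1d i) (hp2d i) hx]
  rfl

/-! ### The Poisson equation with homogeneous right-hand side -/

/-- A smooth radial cutoff supported in an annulus. -/
noncomputable def annulusBump : ContDiffBump (2 : ℝ) := ⟨1 / 2, 1, by norm_num, by norm_num⟩

theorem annulusBump_eq_zero {r : ℝ} (h : r ≤ 1 ∨ 3 ≤ r) : annulusBump r = 0 := by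
  refine annulusBump.zero_of_le_dist ?_
  rw [Real.dist_eq]
  change 1 ≤ _
  rcases h with h | h
  · exact le_trans (by linarith) (neg_le_abs _)
  · exact le_trans (by linarith) (le_abs_self _)

theorem contDiff_cutoff_mul {f : E3 → ℝ} {n : ℕ∞} (hf : ContDiffOn ℝ n f {x | x ≠ 0}) :
    ContDiff ℝ n (fun x => annulusBump (‖x‖ ^ 2) * f x) := by
  rw [contDiff_iff_contDiffAt]
  intro x
  by_cases hx : x = 0
  · subst hx
    have : (fun x : E3 => annulusBump (‖x‖ ^ 2) * f x) =ᶠ[nhds 0] fun _ => 0 := by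
      filter_upwards [Metric.ball_mem_nhds (0 : E3) one_pos] with y hy
      rw [mem_ball_zero_iff] at hy
      rw [annulusBump_eq_zero (Or.inl (pow_le_one₀ (norm_nonneg _) hy.le)), zero_mul]
    exact contDiffAt_const.congr_of_eventuallyEq this
  · exact (annulusBump.contDiff.comp (contDiff_norm_sq ℝ)).contDiffAt.mul
      (hf.contDiffAt (isOpen_ne_zero.mem_nhds hx))

theorem hasCompactSupport_cutoff_mul (f : E3 → ℝ) :
    HasCompactSupport (fun x => annulusBump (‖x‖ ^ 2) * f x) := by
  refine HasCompactSupport.intro (isCompact_closedBall (0 : E3) 2) fun x hx => ?_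
  have : 2 < ‖x‖ := by simpa using hx
  rw [annulusBump_eq_zero (Or.inr (by nlinarith)), zero_mul]

theorem contDiffOn_norm_sq_inv {n : WithTop ℕ∞} :
    ContDiffOn ℝ n (fun x : E3 => (‖x‖ ^ 2)⁻¹) {x | x ≠ 0} :=
  (contDiff_norm_sq ℝ).contDiffOn.inv fun x hx => by
    have : 0 < ‖x‖ := norm_pos_iff.2 hx
    positivity

theorem newtonPot_cutoff_norm_sq_inv_pos :
    0 < newtonPot (fun x => annulusBump (‖x‖ ^ 2) * (‖x‖ ^ 2)⁻¹) 0 := by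
  rw [newtonPot_apply]
  have e : (fun z : E3 => ‖z‖⁻¹ * (annulusBump (‖0 - z‖ ^ 2) * (‖0 - z‖ ^ 2)⁻¹))
      = fun z => annulusBump (‖z‖ ^ 2) * (‖z‖⁻¹ * (‖z‖ ^ 2)⁻¹) := by
    funext z
    rw [zero_sub, norm_neg]
    ring
  rw [e]
  have hx : ‖(EuclideanSpace.single (0 : Fin 3) (√2 : ℝ) : E3)‖ ^ 2 = 2 := by simp
  refine (contDiff_cutoff_mul (n := 0) (contDiffOn_norm_inv.mul
    contDiffOn_norm_sq_inv)).continuous.integral_pos_of_hasCompactSupport_nonneg_nonzero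
    (x := EuclideanSpace.single (0 : Fin 3) (√2 : ℝ)) (hasCompactSupport_cutoff_mul _) ?_ ?_
  · intro z
    have := annulusBump.nonneg (x := ‖z‖ ^ 2)
    change 0 ≤ _
    positivity
  · have h1 : annulusBump 2 = 1 := annulusBump.one_of_mem_closedBall
      (Metric.mem_closedBall_self annulusBump.rIn_pos.le)
    rw [hx, h1]
    simp

theorem newtonPot_sub_const_mul {φ ψ : E3 → ℝ} (hφ : Continuous φ) (hφc : HasCompactSupport φ)
    (hψ : Continuous ψ) (hψc : HasCompactSupport ψ) (c : ℝ) (x : E3) :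
    newtonPot (fun z => φ z - c * ψ z) x = newtonPot φ x - c * newtonPot ψ x := by
  have hi : ∀ f : E3 → ℝ, Continuous f → HasCompactSupport f →
      Integrable (fun z => ‖z‖⁻¹ * f (x - z)) := by
    intro f hf hfc
    have := locallyIntegrable_norm_inv.integrable_smul_right_of_hasCompactSupport
      (hf.comp (Homeomorph.subLeft x).continuous) (hfc.comp_homeomorph (Homeomorph.subLeft x))
    simpa [mul_comm] using this
  rw [newtonPot_apply, newtonPot_apply, newtonPot_apply, ← integral_const_mul,
    ← integral_sub (hi φ hφ hφc) ((hi ψ hψ hψc).const_mul c)]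
  congr 1
  funext z
  ring

theorem exists_homogeneous_solution_of_newtonPot_eq_zero {f : E3 → ℝ}
    (hf : ContDiffOn ℝ 2 f {x | x ≠ 0}) (hhom : HomogNeg 2 f)
    (h0 : newtonPot (fun x => annulusBump (‖x‖ ^ 2) * f x) 0 = 0) :
    ∃ G : E3 → ℝ, ContDiffOn ℝ 2 G {x | x ≠ 0} ∧ HomogNeg 0 G ∧
      ∀ x : E3, x ≠ 0 → ∑ i, pd3 i (pd3 i G) x = f x := by
  set φ : E3 → ℝ := fun x => annulusBump (‖x‖ ^ 2) * f x with hφdef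
  have hφ : ContDiff ℝ 2 φ := contDiff_cutoff_mul (n := 2) hf
  have hφc : HasCompactSupport φ := hasCompactSupport_cutoff_mul f
  have hw : ContDiff ℝ 2 (newtonPot φ) := contDiff_newtonPot (n := 2) hφ hφc
  obtain ⟨d0, d1, d2⟩ := dilDecay_newtonPot hφ hφc h0
  set I0 : ℝ := ∫ t : ℝ, annulusBump (Real.exp t ^ 2) with hI0
  have hI0pos : 0 < I0 := by
    refine Continuous.integral_pos_of_hasCompactSupport_nonneg_nonzero (x := Real.log 2 / 2)
      (annulusBump.continuous.comp (by fun_prop)) ?_ (fun t => annulusBump.nonneg) ?_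
    · refine HasCompactSupport.intro (isCompact_Icc (a := (0 : ℝ)) (b := 3)) fun t ht => ?_
      refine annulusBump_eq_zero ?_
      rw [Set.mem_Icc, not_and_or, not_le, not_le] at ht
      rcases ht with ht | ht
      · exact Or.inl (pow_le_one₀ (Real.exp_pos t).le (Real.exp_le_one_iff.2 ht.le))
      · right
        have := Real.add_one_le_exp t
        nlinarith
    · have : Real.exp (Real.log 2 / 2) ^ 2 = 2 := by
        rw [← Real.exp_nat_mul]
        norm_num [mul_div_cancel₀, Real.exp_log]
      simp only [this]
      rw [annulusBump.one_of_mem_closedBall (Metric.mem_closedBall_self annulusBump.rIn_pos.le)]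
      exact one_ne_zero
  have hM := newtonMass_pos
  have hlap : ∀ x : E3, x ≠ 0 →
      ∑ i, pd3 i (pd3 i (dilInt 0 (newtonPot φ))) x = -(newtonMass * I0) * f x := by
    intro x hx
    have hx' : 0 < ‖x‖ := norm_pos_iff.2 hx
    rw [laplacian_dilInt hw d0 d1 d2 hx, dilInt]
    have e : ∀ t : ℝ, Real.exp t ^ 2 • ∑ i, pd3 i (pd3 i (newtonPot φ)) (Real.exp t • x)
        = -(newtonMass * f x) * annulusBump (Real.exp (t + Real.log ‖x‖) ^ 2) := by
      intro t
      have ht := Real.exp_pos t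
      rw [laplacian_newtonPot hφ hφc, hφdef, Real.exp_add, Real.exp_log hx']
      simp only
      rw [hhom _ ht x hx, norm_smul, Real.norm_of_nonneg ht.le, smul_eq_mul, smul_eq_mul]
      field_simp
    simp_rw [e]
    rw [integral_const_mul, integral_add_right_eq_self
      (fun t : ℝ => (annulusBump (Real.exp t ^ 2) : ℝ)), ← hI0]
    ring
  set a : ℝ := -(newtonMass * I0)⁻¹ with ha
  have hG := contDiffOn_dilInt hw d0 d1 d2
  refine ⟨fun x => a * dilInt 0 (newtonPot φ) x, contDiffOn_const.mul hG, ?_, ?_⟩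
  · intro s hs x _
    simp [dilInt_zero_smul _ hs]
  · intro x hx
    have hmul : ∀ (V : E3 → ℝ) (i : Fin 3) (y : E3),
        pd3 i (fun z => a * V z) y = a * pd3 i V y := by
      intro V i y
      have := congrFun (fderiv_const_smul_field (𝕜 := ℝ) (f := V) a) y
      exact congrArg (fun T => T (EuclideanSpace.single i 1)) this
    have e : ∀ i, pd3 i (fun z => a * dilInt 0 (newtonPot φ) z)
        = fun z => a * pd3 i (dilInt 0 (newtonPot φ)) z := fun i => funext fun y => hmul _ i y
    simp_rw [e, hmul, ← Finset.mul_sum]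
    rw [hlap x hx, ha]
    field_simp

theorem exists_homogeneous_solution {f : E3 → ℝ} (hf : ContDiffOn ℝ 2 f {x | x ≠ 0})
    (hhom : HomogNeg 2 f) :
    ∃ (c : ℝ) (G : E3 → ℝ), ContDiffOn ℝ 2 G {x | x ≠ 0} ∧ HomogNeg 0 G ∧
      ∀ x : E3, x ≠ 0 → ∑ i, pd3 i (pd3 i G) x + c * (‖x‖ ^ 2)⁻¹ = f x := by
  have hp := newtonPot_cutoff_norm_sq_inv_pos
  set c : ℝ := newtonPot (fun x => annulusBump (‖x‖ ^ 2) * f x) 0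
    / newtonPot (fun x => annulusBump (‖x‖ ^ 2) * (‖x‖ ^ 2)⁻¹) 0 with hc
  obtain ⟨G, hG, hGh, hGl⟩ := exists_homogeneous_solution_of_newtonPot_eq_zero
    (f := fun x => f x - c * (‖x‖ ^ 2)⁻¹) (hf.sub (contDiffOn_const.mul contDiffOn_norm_sq_inv))
    (fun s hs x hx => by
      simp only [hhom s hs x hx, norm_smul, Real.norm_of_nonneg hs.le, smul_eq_mul]
      ring) (by
      have e : (fun x : E3 => annulusBump (‖x‖ ^ 2) * (f x - c * (‖x‖ ^ 2)⁻¹))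
          = fun x => annulusBump (‖x‖ ^ 2) * f x
            - c * (annulusBump (‖x‖ ^ 2) * (‖x‖ ^ 2)⁻¹) := by
        funext x
        ring
      rw [e, newtonPot_sub_const_mul (contDiff_cutoff_mul (n := 2) hf).continuous
        (hasCompactSupport_cutoff_mul f)
        (contDiff_cutoff_mul (n := 2) contDiffOn_norm_sq_inv).continuous
        (hasCompactSupport_cutoff_mul _), hc, div_mul_cancel₀ _ hp.ne', sub_self])
  exact ⟨c, G, hG, hGh, fun x hx => by rw [hGl x hx]; ring⟩

/-! ### Harmonic corrections with a logarithmic term -/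

theorem hasFDerivAt_log_norm {x : E3} (hx : x ≠ 0) :
    HasFDerivAt (fun z : E3 => Real.log ‖z‖) ((‖x‖ ^ 2)⁻¹ • innerSL ℝ x) x := by
  have hx' : 0 < ‖x‖ := norm_pos_iff.2 hx
  have h := ((hasStrictFDerivAt_norm_sq x).hasFDerivAt.log (by positivity)).const_mul (1 / 2)
  have e : (fun z : E3 => Real.log ‖z‖) = fun z => 1 / 2 * Real.log (‖z‖ ^ 2) := by
    funext z
    rw [Real.log_pow]
    push_cast
    ring
  rw [e]
  refine h.congr_fderiv ?_
  ext v
  simp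
  ring

theorem homogNeg_log_norm_fderiv :
    HomogNeg 1 (fun x : E3 => (‖x‖ ^ 2)⁻¹ • innerSL ℝ x) := by
  intro s hs x _
  simp only [map_smul, norm_smul, Real.norm_of_nonneg hs.le, smul_smul]
  congr 1
  field_simp

theorem contDiffOn_log_norm_fderiv {n : WithTop ℕ∞} :
    ContDiffOn ℝ n (fun x : E3 => (‖x‖ ^ 2)⁻¹ • innerSL ℝ x) {x | x ≠ 0} :=
  contDiffOn_norm_sq_inv.smul (innerSL ℝ).contDiff.contDiffOn

theorem sum_fderiv_log_norm_fderiv {x : E3} (hx : x ≠ 0) :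
    ∑ i : Fin 3, fderiv ℝ (fun x : E3 => (‖x‖ ^ 2)⁻¹ • innerSL ℝ x) x
      (EuclideanSpace.single i 1) (EuclideanSpace.single i 1) = (‖x‖ ^ 2)⁻¹ := by
  have hx' : 0 < ‖x‖ := norm_pos_iff.2 hx
  have hd : DifferentiableAt ℝ (fun x : E3 => (‖x‖ ^ 2)⁻¹ • innerSL ℝ x) x :=
    ((contDiffOn_log_norm_fderiv (n := 1)).differentiableOn one_ne_zero).differentiableAt
      (isOpen_ne_zero.mem_nhds hx)
  have h1 : HasFDerivAt (fun x : E3 => (‖x‖ ^ 2)⁻¹)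
      (-((‖x‖ ^ 2) ^ 2)⁻¹ • (2 • innerSL ℝ x)) x :=
    (hasDerivAt_inv (by positivity)).comp_hasFDerivAt x (hasStrictFDerivAt_norm_sq x).hasFDerivAt
  have hi (i : Fin 3) : fderiv ℝ (fun x : E3 => (‖x‖ ^ 2)⁻¹ • innerSL ℝ x) x
      (EuclideanSpace.single i 1) (EuclideanSpace.single i 1)
      = (‖x‖ ^ 2)⁻¹ - 2 * ((‖x‖ ^ 2) ^ 2)⁻¹ * x i ^ 2 := by
    have e1 := pd3_eq_of_hasFDerivAt (hd.hasFDerivAt.clm_apply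
      (hasFDerivAt_const (EuclideanSpace.single i (1 : ℝ)) x)) i
    have e2 : (fun y : E3 => ((‖y‖ ^ 2)⁻¹ • innerSL ℝ y) (EuclideanSpace.single i (1 : ℝ)))
        = fun y : E3 => (‖y‖ ^ 2)⁻¹ * y i := by
      funext y
      simp [EuclideanSpace.inner_single_right]
    have e3 := pd3_eq_of_hasFDerivAt
      (h1.mul (EuclideanSpace.proj i : E3 →L[ℝ] ℝ).hasFDerivAt) i
    have e4 : pd3 i (fun y : E3 => (‖y‖ ^ 2)⁻¹ * y i) x
        = (‖x‖ ^ 2)⁻¹ - 2 * ((‖x‖ ^ 2) ^ 2)⁻¹ * x i ^ 2 := by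
      refine e3.trans ?_
      simp [EuclideanSpace.inner_single_right]
      ring
    rw [← e4, ← e2, e1]
    simp
  have hn : ‖x‖ ^ 2 = x 0 ^ 2 + x 1 ^ 2 + x 2 ^ 2 := by
    rw [EuclideanSpace.real_norm_sq_eq, Fin.sum_univ_three]
  have hn' : 0 < x 0 ^ 2 + x 1 ^ 2 + x 2 ^ 2 := hn ▸ by positivity
  simp_rw [hi]
  rw [Fin.sum_univ_three, hn]
  field_simp
  ring

theorem exists_log_homogeneous_solution {f : E3 → ℝ} (hf : ContDiffOn ℝ 2 f {x | x ≠ 0})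
    (hhom : HomogNeg 2 f) :
    ∃ (c : ℝ) (G : E3 → ℝ) (P : E3 → E3 →L[ℝ] ℝ), ContDiffOn ℝ 2 G {x | x ≠ 0} ∧ HomogNeg 0 G ∧
      ContDiffOn ℝ 1 P {x | x ≠ 0} ∧ HomogNeg 1 P ∧
      (∀ x : E3, x ≠ 0 → HasFDerivAt (fun z => Real.log ‖z‖ * c + G z) (P x) x) ∧
      ∀ x : E3, x ≠ 0 →
        ∑ i, fderiv ℝ P x (EuclideanSpace.single i 1) (EuclideanSpace.single i 1) = f x := by
  obtain ⟨c, G, hG, hGh, hGl⟩ := exists_homogeneous_solution hf hhom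
  have hG1 : ContDiffOn ℝ 1 (fderiv ℝ G) {x | x ≠ 0} :=
    hG.fderiv_of_isOpen isOpen_ne_zero (by simp [one_add_one_eq_two])
  have hGd : ∀ x : E3, x ≠ 0 → DifferentiableAt ℝ (fderiv ℝ G) x := fun x hx =>
    (hG1.differentiableOn one_ne_zero).differentiableAt (isOpen_ne_zero.mem_nhds hx)
  have hLd : ∀ x : E3, x ≠ 0 →
      DifferentiableAt ℝ (fun x : E3 => (‖x‖ ^ 2)⁻¹ • innerSL ℝ x) x := fun x hx =>
    ((contDiffOn_log_norm_fderiv (n := 1)).differentiableOn one_ne_zero).differentiableAt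
      (isOpen_ne_zero.mem_nhds hx)
  refine ⟨c, G, fun x => c • ((‖x‖ ^ 2)⁻¹ • innerSL ℝ x) + fderiv ℝ G x, hG, hGh,
    (contDiffOn_log_norm_fderiv.const_smul c).add hG1, ?_, ?_, ?_⟩
  · intro s hs x hx
    simp only [hGh.fderiv s hs x hx, homogNeg_log_norm_fderiv s hs x hx, smul_add]
    rw [smul_comm c]
  · intro x hx
    exact ((hasFDerivAt_log_norm hx).mul_const c).add
      ((hG.differentiableOn two_ne_zero).differentiableAt (isOpen_ne_zero.mem_nhds hx)).hasFDerivAt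
  · intro x hx
    have h := ((hLd x hx).hasFDerivAt.const_smul c).add (hGd x hx).hasFDerivAt
    have h' : fderiv ℝ (fun x : E3 => c • ((‖x‖ ^ 2)⁻¹ • innerSL ℝ x) + fderiv ℝ G x) x = _ :=
      h.fderiv
    rw [h', ← hGl x hx, ← sum_fderiv_log_norm_fderiv hx, Finset.mul_sum, add_comm,
      ← Finset.sum_add_distrib]
    refine Finset.sum_congr rfl fun i _ => ?_
    have : pd3 i (pd3 i G) x
        = fderiv ℝ (fderiv ℝ G) x (EuclideanSpace.single i 1) (EuclideanSpace.single i 1) := by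
      have hp : HasFDerivAt (pd3 i G) _ x := (hGd x hx).hasFDerivAt.clm_apply
        (hasFDerivAt_const (EuclideanSpace.single i (1 : ℝ)) x)
      rw [pd3_eq_of_hasFDerivAt hp]
      simp
    rw [this]
    rfl

/-! ### The densitized inverse metric -/

section LocalBounds

variable {E F : Type*} [NormedAddCommGroup E] [NormedSpace ℝ E] [NormedAddCommGroup F]
  [NormedSpace ℝ F]

theorem ContDiffAt.exists_fderiv_bounds {Φ : E → F} {p : E} (h : ContDiffAt ℝ 2 Φ p) :
    ∃ K, 0 ≤ K ∧ ∀ᶠ M in nhds p, DifferentiableAt ℝ Φ M ∧ ‖Φ M - Φ p‖ ≤ K * ‖M - p‖ ∧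
      ‖fderiv ℝ Φ M‖ ≤ K ∧ ‖fderiv ℝ Φ M - fderiv ℝ Φ p‖ ≤ K * ‖M - p‖ := by
  obtain ⟨K1, t1, ht1, hK1⟩ := (h.of_le one_le_two).exists_lipschitzOnWith
  obtain ⟨K2, t2, ht2, hK2⟩ :=
    (h.fderiv_right (m := 1) (by simp [one_add_one_eq_two])).exists_lipschitzOnWith
  have hc : ContinuousAt (fderiv ℝ Φ) p :=
    (h.fderiv_right (m := 1) (by simp [one_add_one_eq_two])).continuousAt
  refine ⟨max (max K1 K2) (‖fderiv ℝ Φ p‖ + 1), by positivity, ?_⟩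
  filter_upwards [ht1, ht2, h.eventually (by simp),
    hc.norm.eventually (gt_mem_nhds (lt_add_one _))] with M h1 h2 h3 h4
  refine ⟨h3.differentiableAt two_ne_zero, ?_, h4.le.trans (le_max_right _ _), ?_⟩
  · have := hK1.dist_le_mul M h1 p (mem_of_mem_nhds ht1)
    rw [dist_eq_norm, dist_eq_norm] at this
    refine this.trans ?_
    gcongr
    exact (le_max_left _ _).trans (le_max_left _ _)
  · have := hK2.dist_le_mul M h2 p (mem_of_mem_nhds ht2)
    rw [dist_eq_norm, dist_eq_norm] at this
    refine this.trans ?_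
    gcongr
    exact (le_max_right _ _).trans (le_max_left _ _)

end LocalBounds

/-- The densitized inverse `(det M)^{1/2} M⁻¹`. -/
noncomputable def densInv (i j : Fin 3) (M : Fin 3 → Fin 3 → ℝ) : ℝ :=
  Real.sqrt (Matrix.of M).det * (Matrix.of M)⁻¹ i j

theorem contDiff_det_three {n : WithTop ℕ∞} :
    ContDiff ℝ n (fun M : Fin 3 → Fin 3 → ℝ => (Matrix.of M).det) := by
  simp_rw [Matrix.det_fin_three, Matrix.of_apply]
  fun_prop

theorem det_one_three :
    (Matrix.of fun a b : Fin 3 => if a = b then (1 : ℝ) else 0).det = 1 :=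
  Matrix.det_one

theorem contDiffAt_densInv {n : WithTop ℕ∞} (i j : Fin 3) :
    ContDiffAt ℝ n (densInv i j) (fun a b => if a = b then 1 else 0) := by
  have e : densInv i j = fun M : Fin 3 → Fin 3 → ℝ =>
      Real.sqrt (Matrix.of M).det * ((Matrix.of M).det⁻¹ * (Matrix.of M).adjugate i j) := by
    funext M
    rw [densInv, Matrix.inv_def, Ring.inverse_eq_inv', Matrix.smul_apply, smul_eq_mul]
  have hd := (contDiff_det_three (n := n)).contDiffAt
    (x := fun a b : Fin 3 => if a = b then (1 : ℝ) else 0)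
  have h1 := det_one_three
  rw [e]
  refine (hd.sqrt (by rw [h1]; exact one_ne_zero)).mul
    ((hd.inv (by rw [h1]; exact one_ne_zero)).mul (ContDiff.contDiffAt ?_))
  simp_rw [Matrix.adjugate_fin_three]
  fin_cases i <;> fin_cases j <;> simp <;> fun_prop

theorem densInv_one (i j : Fin 3) :
    densInv i j (fun a b => if a = b then 1 else 0) = if i = j then 1 else 0 := by
  have h : (Matrix.of fun a b : Fin 3 => if a = b then (1 : ℝ) else 0) = (1 : Matrix (Fin 3) (Fin 3) ℝ) := by
    ext a b
    rw [Matrix.of_apply, Matrix.one_apply]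
  rw [densInv, h, Matrix.det_one, inv_one, Real.sqrt_one, one_mul, Matrix.one_apply]

theorem eventually_inv_sqrt_det_le :
    ∀ᶠ M in nhds (fun a b : Fin 3 => if a = b then (1 : ℝ) else 0),
      |(Real.sqrt (Matrix.of M).det)⁻¹| ≤ 2 := by
  have h : ContinuousAt (fun M : Fin 3 → Fin 3 → ℝ => |(Real.sqrt (Matrix.of M).det)⁻¹|)
      (fun a b => if a = b then 1 else 0) := by
    refine ((contDiff_det_three (n := 0)).continuous.continuousAt.sqrt.inv₀ ?_).abs
    simp [det_one_three]
  refine (h.eventually_lt_const (u := 2) ?_).mono fun M hM => hM.le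
  simp [det_one_three]

theorem exists_densInv_bounds :
    ∃ K, 0 ≤ K ∧ ∀ᶠ M in nhds (fun a b : Fin 3 => if a = b then (1 : ℝ) else 0), ∀ i j,
      DifferentiableAt ℝ (densInv i j) M ∧
      |densInv i j M - if i = j then 1 else 0| ≤
        K * ‖M - fun a b : Fin 3 => if a = b then (1 : ℝ) else 0‖ ∧
      ‖fderiv ℝ (densInv i j) M‖ ≤ K ∧
      ‖fderiv ℝ (densInv i j) M -
        fderiv ℝ (densInv i j) (fun a b : Fin 3 => if a = b then (1 : ℝ) else 0)‖ ≤
          K * ‖M - fun a b : Fin 3 => if a = b then (1 : ℝ) else 0‖ := by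
  choose K hK0 hK using fun i j => (contDiffAt_densInv (n := 2) i j).exists_fderiv_bounds
  have hle (i j) : K i j ≤ ∑ i, ∑ j, K i j :=
    (Finset.single_le_sum (fun j _ => hK0 i j) (Finset.mem_univ j)).trans
      (Finset.single_le_sum (f := fun i => ∑ j, K i j)
        (fun i _ => Finset.sum_nonneg fun j _ => hK0 i j) (Finset.mem_univ i))
  refine ⟨∑ i, ∑ j, K i j, Finset.sum_nonneg fun i _ => Finset.sum_nonneg fun j _ => hK0 i j, ?_⟩
  filter_upwards [Filter.eventually_all.2 fun i => Filter.eventually_all.2 fun j => hK i j]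
    with M hM i j
  obtain ⟨h1, h2, h3, h4⟩ := hM i j
  rw [densInv_one, Real.norm_eq_abs] at h2
  refine ⟨h1, h2.trans ?_, h3.trans (hle i j), h4.trans ?_⟩
  · gcongr
    exact hle i j
  · gcongr
    exact hle i j

/-! ### Expansion of the Laplace–Beltrami operator -/

theorem lapBel_eq_of_hasFDerivAt {g : E3 → Matrix (Fin 3) (Fin 3) ℝ} {γ : E3 → Fin 3 → Fin 3 → ℝ}
    {γ' : E3 →L[ℝ] Fin 3 → Fin 3 → ℝ} {f : E3 → ℝ} {P : E3 → E3 →L[ℝ] ℝ}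
    {P' : E3 →L[ℝ] E3 →L[ℝ] ℝ} {x : E3} (hg : ∀ᶠ z in nhds x, g z = Matrix.of (γ z))
    (hγ : HasFDerivAt γ γ' x) (hd : ∀ i j, DifferentiableAt ℝ (densInv i j) (γ x))
    (hf : ∀ᶠ z in nhds x, HasFDerivAt f (P z) z) (hP : HasFDerivAt P P' x) :
    lapBel g f x = (Real.sqrt (Matrix.of (γ x)).det)⁻¹ * ∑ i, ∑ j,
      (fderiv ℝ (densInv i j) (γ x) (γ' (EuclideanSpace.single i 1))
          * P x (EuclideanSpace.single j 1)
        + densInv i j (γ x) * P' (EuclideanSpace.single i 1) (EuclideanSpace.single j 1)) := by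
  rw [lapBel, hg.self_of_nhds]
  congr 1
  refine Finset.sum_congr rfl fun i _ => ?_
  have e : (fun z => Real.sqrt (g z).det * ∑ j, ((g z)⁻¹ i j) * pd3 j f z) =ᶠ[nhds x]
      fun z => ∑ j, densInv i j (γ z) * P z (EuclideanSpace.single j 1) := by
    filter_upwards [hg, hf] with z hz hfz
    rw [hz, Finset.mul_sum]
    refine Finset.sum_congr rfl fun j _ => ?_
    rw [pd3_eq_of_hasFDerivAt hfz, densInv, mul_assoc]
  have h (j : Fin 3) : HasFDerivAt
      (fun z => densInv i j (γ z) * P z (EuclideanSpace.single j 1)) _ x :=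
    ((hd i j).hasFDerivAt.comp x hγ).mul
      (hP.clm_apply (hasFDerivAt_const (EuclideanSpace.single j (1 : ℝ)) x))
  rw [pd3, e.fderiv_eq, (HasFDerivAt.fun_sum fun j _ => h j).fderiv,
    _root_.sum_apply]
  refine Finset.sum_congr rfl fun j _ => ?_
  simp
  ring

theorem sum_lapBel_expansion (k : Fin 3) (D L N q : Fin 3 → Fin 3 → ℝ) (p : Fin 3 → ℝ)
    (h : ∑ i, q i i = -∑ i, L i k) :
    ∑ i, ∑ j, (D i j * ((if j = k then 1 else 0) + p j) + N i j * q i j) =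
      ∑ i, ∑ j, ((if j = k then 1 else 0) * (D i j - L i j) + D i j * p j
        + (N i j - if i = j then 1 else 0) * q i j) := by
  have h0 : ∑ i, ∑ j, ((if j = k then 1 else 0) * L i j + (if i = j then 1 else 0) * q i j)
      = 0 := by
    simp [Finset.sum_add_distrib, h]
  refine sub_eq_zero.1 (Eq.trans ?_ h0)
  rw [← Finset.sum_sub_distrib]
  refine Finset.sum_congr rfl fun i _ => ?_
  rw [← Finset.sum_sub_distrib]
  refine Finset.sum_congr rfl fun j _ => ?_
  ring

theorem abs_lapBel_term_le {E : Type*} [NormedAddCommGroup E] [NormedSpace ℝ E] {K A ρ n : ℝ}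
    {T T₀ : E →L[ℝ] ℝ} {u u₀ : E} {d ε p q : ℝ} (hK : 0 ≤ K) (hA : 0 ≤ A)
    (hρ : 0 ≤ ρ) (hd : |d| ≤ 1) (hn : n ≤ A * ρ) (hT : ‖T‖ ≤ K) (hT₀ : ‖T₀‖ ≤ K)
    (hTT : ‖T - T₀‖ ≤ K * n) (hu : ‖u‖ ≤ A * ρ ^ 2) (huu : ‖u - u₀‖ ≤ A * ρ ^ 3)
    (hε : |ε| ≤ K * n) (hp : |p| ≤ A * ρ) (hq : |q| ≤ A * ρ ^ 2) :
    |d * (T u - T₀ u₀) + T u * p + ε * q| ≤ (3 * K * A ^ 2 + K * A) * ρ ^ 3 := by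
  have hTT' : ‖T - T₀‖ ≤ K * (A * ρ) := hTT.trans (by gcongr)
  have hε' : |ε| ≤ K * (A * ρ) := hε.trans (by gcongr)
  have h1 : |T u| ≤ K * (A * ρ ^ 2) := T.le_of_opNorm_le_of_le hT hu
  have h2 : |T u - T₀ u₀| ≤ K * (A * ρ) * (A * ρ ^ 2) + K * (A * ρ ^ 3) := by
    have e : T u - T₀ u₀ = (T - T₀) u + T₀ (u - u₀) := by
      rw [_root_.sub_apply, map_sub]
      ring
    rw [e]
    exact (abs_add_le _ _).trans (add_le_add ((T - T₀).le_of_opNorm_le_of_le hTT' hu)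
      (T₀.le_of_opNorm_le_of_le hT₀ huu))
  calc |d * (T u - T₀ u₀) + T u * p + ε * q|
      ≤ |d| * |T u - T₀ u₀| + |T u| * |p| + |ε| * |q| := by
        rw [← abs_mul, ← abs_mul, ← abs_mul]
        exact abs_add_three _ _ _
    _ ≤ 1 * (K * (A * ρ) * (A * ρ ^ 2) + K * (A * ρ ^ 3)) + K * (A * ρ ^ 2) * (A * ρ)
        + K * (A * ρ) * (A * ρ ^ 2) := by gcongr
    _ = _ := by ring

theorem exists_harmonic_coordinate {H Q : E3 → Fin 3 → Fin 3 → ℝ}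
    (hH : ContDiffOn ℝ 3 H {x | x ≠ 0}) (hHh : HomogNeg 1 H) {B : ℝ} (hB : 0 ≤ B)
    (hQd : ∀ x : E3, 1 < ‖x‖ → DifferentiableAt ℝ Q x)
    (hQ0 : ∀ x : E3, 1 < ‖x‖ → ‖Q x‖ ≤ B * (‖x‖ ^ 2)⁻¹)
    (hQ1 : ∀ x : E3, 1 < ‖x‖ → ‖fderiv ℝ Q x‖ ≤ B * (‖x‖ ^ 3)⁻¹)
    {g : E3 → Matrix (Fin 3) (Fin 3) ℝ}
    (hg : ∀ x : E3, 1 < ‖x‖ →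
      g x = Matrix.of ((fun a b => if a = b then 1 else 0) + H x + Q x)) (k : Fin 3) :
    ∃ (c : ℝ) (G : E3 → ℝ) (R K : ℝ), ContDiffOn ℝ 2 G {x | x ≠ 0} ∧ HomogNeg 0 G ∧
      ∀ x : E3, R ≤ ‖x‖ →
        |lapBel g (fun z => z k + Real.log ‖z‖ * c + G z) x| ≤ K * (‖x‖ ^ 3)⁻¹ ∧
        ∀ i, |pd3 i (fun z => z k + Real.log ‖z‖ * c + G z) x - if k = i then 1 else 0|
          ≤ K * ‖x‖⁻¹ := by
  set δ : Fin 3 → Fin 3 → ℝ := fun a b => if a = b then 1 else 0 with hδ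
  have hHd : ∀ x : E3, x ≠ 0 → DifferentiableAt ℝ H x := fun x hx =>
    (hH.differentiableOn three_ne_zero).differentiableAt (isOpen_ne_zero.mem_nhds hx)
  have hH1 : ContDiffOn ℝ 2 (fderiv ℝ H) {x | x ≠ 0} :=
    hH.fderiv_of_isOpen isOpen_ne_zero (by norm_num)
  obtain ⟨c, G, P, hG, hGh, hP, hPh, hPd, hPl⟩ := exists_log_homogeneous_solution
    (f := fun x => -∑ i, fderiv ℝ (densInv i k) δ (fderiv ℝ H x (EuclideanSpace.single i 1)))
    (ContDiffOn.neg (ContDiffOn.sum fun i _ => (fderiv ℝ (densInv i k) δ).contDiff.comp_contDiffOn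
      (hH1.clm_apply contDiffOn_const))) (fun s hs x hx => by
      simp [hHh.fderiv s hs x hx, Finset.mul_sum])
  have hPd' : ∀ x : E3, x ≠ 0 → DifferentiableAt ℝ P x := fun x hx =>
    (hP.differentiableOn one_ne_zero).differentiableAt (isOpen_ne_zero.mem_nhds hx)
  obtain ⟨A1, hA1, hA1'⟩ := hHh.bound hH.continuousOn
  obtain ⟨A2, hA2, hA2'⟩ := hHh.fderiv.bound hH1.continuousOn
  obtain ⟨A3, hA3, hA3'⟩ := hPh.bound hP.continuousOn
  obtain ⟨A4, hA4, hA4'⟩ := hPh.fderiv.bound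
    (hP.continuousOn_fderiv_of_isOpen isOpen_ne_zero le_rfl)
  obtain ⟨K, hK, hKe⟩ := exists_densInv_bounds
  obtain ⟨r, hr, hball⟩ := Metric.eventually_nhds_iff.1 (hKe.and eventually_inv_sqrt_det_le)
  have hself := hKe.self_of_nhds
  set A := A1 + A2 + A3 + A4 + B with hA
  have hA0 : 0 ≤ A := by positivity
  have hpos : 0 ≤ 3 * K * A ^ 2 + K * A := by positivity
  refine ⟨c, G, 2 + A / r, 18 * (3 * K * A ^ 2 + K * A) + A, hG, hGh, fun x hx => ?_⟩
  have hAr : 0 ≤ A / r := by positivity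
  have hx1 : 1 < ‖x‖ := by linarith
  have hx' : 0 < ‖x‖ := by linarith
  have hx0 : x ≠ 0 := norm_pos_iff.1 hx'
  set ρ := ‖x‖⁻¹ with hρ
  have hρ0 : 0 < ρ := by positivity
  have hρ1 : ρ ≤ 1 := inv_le_one_of_one_le₀ hx1.le
  simp only [← inv_pow, ← hρ] at hA1' hA2' hA3' hA4' hQ0 hQ1 ⊢
  have bH := hA1' x hx0
  have bH1 := hA2' x hx0
  have bP := hA3' x hx0
  have bP1 := hA4' x hx0
  have bQ := hQ0 x hx1
  have bQ1 := hQ1 x hx1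
  rw [← hρ] at bH bH1 bP bP1 bQ bQ1
  have hρ21 : ρ ^ 2 ≤ ρ := by nlinarith
  have hρ32 : ρ ^ 3 ≤ ρ ^ 2 := pow_le_pow_of_le_one hρ0.le hρ1 (by norm_num)
  set γ : E3 → Fin 3 → Fin 3 → ℝ := fun z => δ + H z + Q z with hγ
  have hγd : HasFDerivAt γ (fderiv ℝ H x + fderiv ℝ Q x) x :=
    ((hHd x hx0).hasFDerivAt.const_add δ).add (hQd x hx1).hasFDerivAt
  have hn : ‖γ x - δ‖ ≤ A * ρ := by
    have : γ x - δ = H x + Q x := by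
      simp only [hγ]
      abel
    rw [this]
    calc ‖H x + Q x‖ ≤ A1 * ρ ^ 1 + B * ρ ^ 2 := (norm_add_le _ _).trans (add_le_add bH bQ)
      _ ≤ A1 * ρ + B * ρ := by rw [pow_one]; gcongr
      _ = (A1 + B) * ρ := by ring
      _ ≤ A * ρ := by gcongr; linarith
  have hnr : dist (γ x) δ < r := by
    rw [dist_eq_norm]
    refine hn.trans_lt ?_
    rw [hρ, ← div_eq_mul_inv, div_lt_iff₀ hx', mul_comm, ← div_lt_iff₀ hr]
    linarith
  obtain ⟨hb, hdet⟩ := hball hnr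
  have hγ' (i : Fin 3) : ‖(fderiv ℝ H x + fderiv ℝ Q x) (EuclideanSpace.single i 1)‖
      ≤ A * ρ ^ 2 := by
    have h1 : ‖fderiv ℝ H x + fderiv ℝ Q x‖ ≤ A * ρ ^ 2 := by
      calc ‖fderiv ℝ H x + fderiv ℝ Q x‖ ≤ A2 * ρ ^ 2 + B * ρ ^ 3 :=
            (norm_add_le _ _).trans (add_le_add bH1 bQ1)
        _ ≤ A2 * ρ ^ 2 + B * ρ ^ 2 := by gcongr
        _ = (A2 + B) * ρ ^ 2 := by ring
        _ ≤ A * ρ ^ 2 := by gcongr; linarith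
    simpa using ContinuousLinearMap.le_of_opNorm_le _ h1 (EuclideanSpace.single i (1 : ℝ))
  have hsub (i : Fin 3) : ‖(fderiv ℝ H x + fderiv ℝ Q x) (EuclideanSpace.single i 1)
      - fderiv ℝ H x (EuclideanSpace.single i 1)‖ ≤ A * ρ ^ 3 := by
    have h1 : ‖fderiv ℝ Q x‖ ≤ A * ρ ^ 3 := bQ1.trans (by gcongr; linarith)
    rw [_root_.add_apply, add_sub_cancel_left]
    simpa using ContinuousLinearMap.le_of_opNorm_le _ h1 (EuclideanSpace.single i (1 : ℝ))
  have hp (j : Fin 3) : |P x (EuclideanSpace.single j 1)| ≤ A * ρ := by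
    have h1 : ‖P x‖ ≤ A * ρ := bP.trans (by rw [pow_one]; gcongr; linarith)
    simpa using ContinuousLinearMap.le_of_opNorm_le _ h1 (EuclideanSpace.single j (1 : ℝ))
  have hq (i j : Fin 3) :
      |fderiv ℝ P x (EuclideanSpace.single i 1) (EuclideanSpace.single j 1)| ≤ A * ρ ^ 2 := by
    have h1 : ‖fderiv ℝ P x‖ ≤ A * ρ ^ 2 := bP1.trans (by gcongr; linarith)
    have h2 : ‖fderiv ℝ P x (EuclideanSpace.single i 1)‖ ≤ A * ρ ^ 2 := by
      simpa using ContinuousLinearMap.le_of_opNorm_le _ h1 (EuclideanSpace.single i (1 : ℝ))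
    simpa using ContinuousLinearMap.le_of_opNorm_le _ h2 (EuclideanSpace.single j (1 : ℝ))
  have hy : ∀ z : E3, z ≠ 0 → HasFDerivAt (fun z : E3 => z k + Real.log ‖z‖ * c + G z)
      ((EuclideanSpace.proj k : E3 →L[ℝ] ℝ) + P z) z := by
    intro z hz
    have := (EuclideanSpace.proj k : E3 →L[ℝ] ℝ).hasFDerivAt.add (hPd z hz)
    refine this.congr_of_eventuallyEq (Filter.Eventually.of_forall fun w => ?_)
    simp [add_assoc]
  have hproj (j : Fin 3) : ((EuclideanSpace.proj k : E3 →L[ℝ] ℝ) + P x)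
      (EuclideanSpace.single j 1) =
      (if j = k then 1 else 0) + P x (EuclideanSpace.single j 1) := by
    simp [eq_comm]
  constructor
  · rw [lapBel_eq_of_hasFDerivAt (γ := γ)
      (P := fun z => (EuclideanSpace.proj k : E3 →L[ℝ] ℝ) + P z)
      (Filter.eventually_of_mem ((isOpen_lt continuous_const continuous_norm).mem_nhds hx1) hg)
      hγd (fun i j => (hb i j).1)
      (Filter.eventually_of_mem (isOpen_ne_zero.mem_nhds hx0) hy)
      ((hPd' x hx0).hasFDerivAt.const_add _)]
    simp only [hproj]
    rw [sum_lapBel_expansion k _ (fun i j => fderiv ℝ (densInv i j) δ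
        (fderiv ℝ H x (EuclideanSpace.single i 1))) _ _ _ (hPl x hx0), abs_mul]
    have hsum : |∑ i, ∑ j, ((if j = k then 1 else 0)
        * (fderiv ℝ (densInv i j) (γ x) ((fderiv ℝ H x + fderiv ℝ Q x) (EuclideanSpace.single i 1))
          - fderiv ℝ (densInv i j) δ (fderiv ℝ H x (EuclideanSpace.single i 1)))
        + fderiv ℝ (densInv i j) (γ x) ((fderiv ℝ H x + fderiv ℝ Q x) (EuclideanSpace.single i 1))
          * P x (EuclideanSpace.single j 1)
        + (densInv i j (γ x) - if i = j then 1 else 0)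
          * fderiv ℝ P x (EuclideanSpace.single i 1) (EuclideanSpace.single j 1))|
        ≤ 9 * ((3 * K * A ^ 2 + K * A) * ρ ^ 3) := by
      refine (Finset.abs_sum_le_sum_abs _ _).trans ?_
      refine (Finset.sum_le_sum fun i _ => (Finset.abs_sum_le_sum_abs _ _).trans
        (Finset.sum_le_sum fun j _ => abs_lapBel_term_le hK hA0 hρ0.le (by split_ifs <;> simp) hn
          (hb i j).2.2.1 (hself i j).2.2.1 (hb i j).2.2.2 (hγ' i) (hsub i) (hb i j).2.1 (hp j)
          (hq i j))).trans ?_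
      simp only [Finset.sum_const, Finset.card_univ, Fintype.card_fin, nsmul_eq_mul]
      push_cast
      linarith
    calc _ ≤ 2 * (9 * ((3 * K * A ^ 2 + K * A) * ρ ^ 3)) := by gcongr
      _ = 18 * (3 * K * A ^ 2 + K * A) * ρ ^ 3 := by ring
      _ ≤ _ := by gcongr; linarith
  · intro i
    rw [pd3_eq_of_hasFDerivAt (hy x hx0), hproj]
    simp only [eq_comm (a := k), add_sub_cancel_left]
    refine (hp i).trans ?_
    gcongr
    linarith

/-- Existence of asymptotically harmonic coordinates: let `g = δ + h¹(x/|x|)/|x| + Q` on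
`{|x| > 1} ⊂ ℝ³`, where `h¹` is a `C⁵` symmetric-matrix-valued function on the unit sphere
(represented by its constant extension along rays) and `|∂^α Q| ≤ C|x|^{-2-|α|}` for `|α| ≤ 5`,
with `g` positive definite.  Then there are `R ≥ 1`, a constant vector `c ∈ ℝ³`, a `C²` map
`G : S² → ℝ³` (represented by its constant extension along rays) and `C' > 0` such that
`y(x) = x + c log|x| + G(x/|x|)` satisfies `|Δ_g y^k| ≤ C' |x|⁻³` for `|x| ≥ R`, and
`∂y^k/∂x^i = δ_{ki} + O(|x|⁻¹)`. -/
theorem exists_asymptotically_harmonic_coordinates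
    (g h1 Q : EuclideanSpace ℝ (Fin 3) → Matrix (Fin 3) (Fin 3) ℝ) (C : ℝ)
    (hh1symm : ∀ (x : EuclideanSpace ℝ (Fin 3)) (i j : Fin 3), h1 x i j = h1 x j i)
    (hh1hom : ∀ x : EuclideanSpace ℝ (Fin 3), x ≠ 0 → h1 x = h1 (‖x‖⁻¹ • x))
    (hh1reg : ∀ i j : Fin 3,
      ContDiffOn ℝ 5 (fun x => h1 x i j) {x : EuclideanSpace ℝ (Fin 3) | x ≠ 0})
    (hQreg : ∀ i j : Fin 3,
      ContDiffOn ℝ 5 (fun x => Q x i j) {x : EuclideanSpace ℝ (Fin 3) | 1 < ‖x‖})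
    (hQdecay : ∀ n : ℕ, n ≤ 5 → ∀ i j : Fin 3, ∀ x : EuclideanSpace ℝ (Fin 3), 1 < ‖x‖ →
      ‖iteratedFDeriv ℝ n (fun z => Q z i j) x‖ ≤ C * ‖x‖ ^ (-(2 : ℝ) - n))
    (hg : ∀ x : EuclideanSpace ℝ (Fin 3), 1 < ‖x‖ → ∀ i j : Fin 3,
      g x i j = (if i = j then (1 : ℝ) else 0) + h1 x i j / ‖x‖ + Q x i j)
    (hpos : ∀ x : EuclideanSpace ℝ (Fin 3), 1 < ‖x‖ → (g x).PosDef) :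
    ∃ (R : ℝ) (c : EuclideanSpace ℝ (Fin 3))
      (G : EuclideanSpace ℝ (Fin 3) → EuclideanSpace ℝ (Fin 3)) (C' : ℝ),
      1 ≤ R ∧ 0 < C' ∧
      ContDiffOn ℝ 2 G {x : EuclideanSpace ℝ (Fin 3) | x ≠ 0} ∧
      (∀ x : EuclideanSpace ℝ (Fin 3), x ≠ 0 → G x = G (‖x‖⁻¹ • x)) ∧
      ∀ x : EuclideanSpace ℝ (Fin 3), R ≤ ‖x‖ →
        (∀ k : Fin 3,
          |lapBel g (fun z => z k + Real.log ‖z‖ * c k + G z k) x| ≤ C' * ‖x‖ ^ (-(3 : ℝ))) ∧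
        (∀ k i : Fin 3,
          |pd3 i (fun z => z k + Real.log ‖z‖ * c k + G z k) x -
              (if k = i then (1 : ℝ) else 0)| ≤ C' * ‖x‖⁻¹) := by
  have hrpow3 (x : EuclideanSpace ℝ (Fin 3)) : ‖x‖ ^ (-(3 : ℝ)) = (‖x‖ ^ 3)⁻¹ := by
    rw [Real.rpow_neg (norm_nonneg x)]
    norm_cast
  have hrpow2 (x : EuclideanSpace ℝ (Fin 3)) : ‖x‖ ^ (-(2 : ℝ)) = (‖x‖ ^ 2)⁻¹ := by
    rw [Real.rpow_neg (norm_nonneg x)]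
    norm_cast
  have hQd (x : EuclideanSpace ℝ (Fin 3)) (hx : 1 < ‖x‖) (i j : Fin 3) :
      DifferentiableAt ℝ (fun z => Q z i j) x :=
    ((hQreg i j).differentiableOn (by norm_num)).differentiableAt
      ((isOpen_lt continuous_const continuous_norm).mem_nhds hx)
  have hQd' (x : EuclideanSpace ℝ (Fin 3)) (hx : 1 < ‖x‖) :
      HasFDerivAt (fun z => (fun a b => Q z a b : Fin 3 → Fin 3 → ℝ))
        (ContinuousLinearMap.pi fun a => ContinuousLinearMap.pi fun b =>
          fderiv ℝ (fun z => Q z a b) x) x :=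
    hasFDerivAt_pi.2 fun a => hasFDerivAt_pi.2 fun b => (hQd x hx a b).hasFDerivAt
  have hH : ContDiffOn ℝ 3 (fun x => (fun a b => h1 x a b / ‖x‖ : Fin 3 → Fin 3 → ℝ))
      {x : EuclideanSpace ℝ (Fin 3) | x ≠ 0} :=
    contDiffOn_pi.2 fun a => contDiffOn_pi.2 fun b => by
      simp only [div_eq_mul_inv]
      exact ((hh1reg a b).of_le (by norm_num)).mul contDiffOn_norm_inv
  have hHh : HomogNeg 1 (fun x => (fun a b => h1 x a b / ‖x‖ : Fin 3 → Fin 3 → ℝ)) := by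
    intro s hs x hx
    have e : h1 (s • x) = h1 x := by
      rw [hh1hom _ (smul_ne_zero hs.ne' hx), hh1hom x hx, norm_smul, Real.norm_of_nonneg hs.le,
        smul_smul, mul_inv, mul_right_comm, inv_mul_cancel₀ hs.ne', one_mul]
    ext a b
    simp only [e, norm_smul, Real.norm_of_nonneg hs.le, Pi.smul_apply, smul_eq_mul]
    field_simp
  have key := exists_harmonic_coordinate hH hHh (abs_nonneg C)
    (Q := fun z => (fun a b => Q z a b : Fin 3 → Fin 3 → ℝ)) (g := g)
    (fun x hx => (hQd' x hx).differentiableAt)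
    (fun x hx => (pi_norm_le_iff_of_nonneg (by positivity)).2 fun a =>
      (pi_norm_le_iff_of_nonneg (by positivity)).2 fun b => by
        have := hQdecay 0 (by norm_num) a b x hx
        rw [norm_iteratedFDeriv_zero, Nat.cast_zero, sub_zero, hrpow2] at this
        exact this.trans (by gcongr; exact le_abs_self C))
    (fun x hx => by
      rw [(hQd' x hx).fderiv]
      refine ContinuousLinearMap.opNorm_le_bound _ (by positivity) fun v =>
        (pi_norm_le_iff_of_nonneg (by positivity)).2 fun a =>
        (pi_norm_le_iff_of_nonneg (by positivity)).2 fun b =>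
        ContinuousLinearMap.le_of_opNorm_le _ ?_ v
      have := hQdecay 1 (by norm_num) a b x hx
      rw [norm_iteratedFDeriv_one, Nat.cast_one, show -(2 : ℝ) - 1 = -3 by norm_num,
        hrpow3] at this
      exact this.trans (by gcongr; exact le_abs_self C))
    (fun x hx => by
      ext a b
      simpa using hg x hx a b)
  choose c G R K hG hGh hb using key
  have hRle (k : Fin 3) : R k ≤ 1 + ∑ k, |R k| := by
    have := Finset.single_le_sum (f := fun k => |R k|) (fun k _ => abs_nonneg _)
      (Finset.mem_univ k)
    linarith [le_abs_self (R k)]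
  have hKle (k : Fin 3) : K k ≤ 1 + ∑ k, |K k| := by
    have := Finset.single_le_sum (f := fun k => |K k|) (fun k _ => abs_nonneg _)
      (Finset.mem_univ k)
    linarith [le_abs_self (K k)]
  refine ⟨1 + ∑ k, |R k|, WithLp.toLp 2 c, fun x => WithLp.toLp 2 fun k => G k x,
    1 + ∑ k, |K k|, le_add_of_nonneg_right (by positivity), by positivity,
    (contDiffOn_piLp 2).2 hG, fun x hx => ?_, fun x hx => ⟨fun k => ?_, fun k i => ?_⟩⟩
  · ext k
    change G k x = G k (‖x‖⁻¹ • x)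
    rw [hGh k _ (inv_pos.2 (norm_pos_iff.2 hx)) x hx]
    simp
  · rw [hrpow3]
    refine ((hb k x ((hRle k).trans hx)).1).trans ?_
    gcongr
    exact hKle k
  · refine ((hb k x ((hRle k).trans hx)).2 i).trans ?_
    gcongr
    exact hKle k
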